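/- arXiv:2005.04676 — 3 statements merged into one kernel-verified Lean document; each statement's English description precedes it below -/
import Mathlib

section
/- Let λ ∈ ℂ, let a < b be real numbers, let h > 0, and let w : ℝ² → ℂ be a function which, together with its first partial derivatives, is continuous on (a,b) × [0,h). Define, for (x₁,x₂) ∈ (a,b) × (−h,0), w̃(x₁,x₂) := w(x₁,−x₂) + 2iλ e^{−iλx₂} ∫₀^{−x₂} e^{−iλs} w(x₁,s) ds. Then for every x₁ ∈ (a,b): (i) w̃(x₁,x₂) → w(x₁,0) as x₂ → 0⁻; and (ii) ∂₂w̃(x₁,x₂) → −∂₂w(x₁,0) − 2iλ w(x₁,0) as x₂ → 0⁻. In particular, if ∂₂w(x₁,0) + iλ w(x₁,0) = 0, then ∂₂w̃(x₁,x₂) → ∂₂w(x₁,0) as x₂ → 0⁻, so the Cauchy data of w and w̃ match across the line {x₂ = 0}. -/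
noncomputable section

open Set

/-- The first partial derivative of `f : ℝ × ℝ → ℂ`. -/
def pd1 (f : ℝ × ℝ → ℂ) (x : ℝ × ℝ) : ℂ := deriv (fun s : ℝ => f (s, x.2)) x.1

/-- The second partial derivative of `f : ℝ × ℝ → ℂ`. -/
def pd2 (f : ℝ × ℝ → ℂ) (x : ℝ × ℝ) : ℂ := deriv (fun s : ℝ => f (x.1, s)) x.2

/-- `w` is harmonic on `S`: twice continuously differentiable with `Δw = 0` on `S`. -/
def HarmonicOn (w : ℝ × ℝ → ℂ) (S : Set (ℝ × ℝ)) : Prop :=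
  ContDiffOn ℝ 2 w S ∧ ∀ x ∈ S, pd1 (pd1 w) x + pd2 (pd2 w) x = 0

/-- `u` solves the Helmholtz equation `Δu + k²u = 0` on `S` (twice continuously
differentiable solutions). -/
def HelmholtzEq (k : ℂ) (u : ℝ × ℝ → ℂ) (S : Set (ℝ × ℝ)) : Prop :=
  ContDiffOn ℝ 2 u S ∧ ∀ x ∈ S, pd1 (pd1 u) x + pd2 (pd2 u) x + k ^ 2 * u x = 0

/-- The reflected extension
`w̃(x₁,x₂) = w(x₁,-x₂) + 2iλ e^{-iλx₂} ∫₀^{-x₂} e^{-iλs} w(x₁,s) ds`. -/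
def wext (lam : ℂ) (w : ℝ × ℝ → ℂ) (x : ℝ × ℝ) : ℂ :=
  w ((x.1, -x.2) : ℝ × ℝ) +
    2 * Complex.I * lam * Complex.exp (-(Complex.I * lam * (x.2 : ℂ))) *
      ∫ s in (0:ℝ)..(-x.2), Complex.exp (-(Complex.I * lam * (s : ℂ))) * w ((x.1, s) : ℝ × ℝ)

/-- **Matching of Cauchy data across `{x₂ = 0}` (Remark 4.1 computation).**
If `w` and its first partial derivatives (with boundary values `g1, g2`) are continuous on
`(a,b) × [0,h)`, then for every `x₁ ∈ (a,b)`, as `x₂ → 0⁻`: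
(i) `w̃(x₁,x₂) → w(x₁,0)`;
(ii) `∂₂w̃(x₁,x₂) → -∂₂w(x₁,0) - 2iλ w(x₁,0)`;
and in particular, if `∂₂w(x₁,0) + iλ w(x₁,0) = 0`, then `∂₂w̃(x₁,x₂) → ∂₂w(x₁,0)`. -/
theorem cauchy_data_matching
    (lam : ℂ) (a b h : ℝ) (hab : a < b) (hh : 0 < h)
    (w g1 g2 : ℝ × ℝ → ℂ)
    (hwc : ContinuousOn w (Set.Ioo a b ×ˢ Set.Ico 0 h))
    (hg1c : ContinuousOn g1 (Set.Ioo a b ×ˢ Set.Ico 0 h))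
    (hg2c : ContinuousOn g2 (Set.Ioo a b ×ˢ Set.Ico 0 h))
    (hd : ∀ x ∈ Set.Ioo a b ×ˢ Set.Ioo 0 h,
      HasDerivAt (fun s : ℝ => w ((s, x.2) : ℝ × ℝ)) (g1 x) x.1 ∧
      HasDerivAt (fun s : ℝ => w ((x.1, s) : ℝ × ℝ)) (g2 x) x.2) :
    ∀ x₁ ∈ Set.Ioo a b,
      Filter.Tendsto (fun t : ℝ => wext lam w ((x₁, t) : ℝ × ℝ))
          (nhdsWithin 0 (Set.Iio 0)) (nhds (w ((x₁, 0) : ℝ × ℝ))) ∧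
      Filter.Tendsto (fun t : ℝ => pd2 (wext lam w) ((x₁, t) : ℝ × ℝ))
          (nhdsWithin 0 (Set.Iio 0))
          (nhds (-g2 ((x₁, 0) : ℝ × ℝ) - 2 * Complex.I * lam * w ((x₁, 0) : ℝ × ℝ))) ∧
      (g2 ((x₁, 0) : ℝ × ℝ) + Complex.I * lam * w ((x₁, 0) : ℝ × ℝ) = 0 →
        Filter.Tendsto (fun t : ℝ => pd2 (wext lam w) ((x₁, t) : ℝ × ℝ))
          (nhdsWithin 0 (Set.Iio 0)) (nhds (g2 ((x₁, 0) : ℝ × ℝ)))) := by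
  intro x₁ hx₁
  have hW : ContinuousOn (fun s : ℝ => w ((x₁, s) : ℝ × ℝ)) (Set.Ico 0 h) :=
    hwc.comp (by fun_prop) (fun s hs => ⟨hx₁, hs⟩)
  have hG : ContinuousOn (fun s : ℝ => g2 ((x₁, s) : ℝ × ℝ)) (Set.Ico 0 h) :=
    hg2c.comp (by fun_prop) (fun s hs => ⟨hx₁, hs⟩)
  have hE : Continuous (fun s : ℝ => Complex.exp (-(Complex.I * lam * (s : ℂ)))) := by
    fun_prop
  have hf : ContinuousOn (fun s : ℝ => Complex.exp (-(Complex.I * lam * (s : ℂ))) *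
      w ((x₁, s) : ℝ × ℝ)) (Set.Ico 0 h) := hE.continuousOn.mul hW
  have hneg : Filter.Tendsto (fun t : ℝ => -t) (nhdsWithin 0 (Set.Iio 0))
      (nhdsWithin 0 (Set.Ico 0 h)) := by
    apply tendsto_nhdsWithin_of_tendsto_nhds_of_eventually_within
    · have : Filter.Tendsto (fun t : ℝ => -t) (nhds 0) (nhds (-0)) :=
        continuous_neg.tendsto 0
      rw [neg_zero] at this
      exact this.mono_left nhdsWithin_le_nhds
    · filter_upwards [Ioo_mem_nhdsLT (show -h < 0 by linarith)] with t ht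
      exact ⟨by linarith [ht.2], by linarith [ht.1]⟩
  have h0 : (0:ℝ) ∈ Set.Ico 0 h := ⟨le_refl _, hh⟩
  have hWt := (hW 0 h0).tendsto.comp hneg
  have hGt := (hG 0 h0).tendsto.comp hneg
  have hEt : Filter.Tendsto (fun t : ℝ => Complex.exp (-(Complex.I * lam * (t : ℂ))))
      (nhdsWithin 0 (Set.Iio 0)) (nhds 1) := by
    have := (hE.tendsto 0).mono_left (nhdsWithin_le_nhds (s := Set.Iio 0))
    simpa using this
  have hEt' : Filter.Tendsto (fun t : ℝ => Complex.exp (-(Complex.I * lam * ((-t : ℝ) : ℂ))))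
      (nhdsWithin 0 (Set.Iio 0)) (nhds 1) := by
    have := ((hE.comp continuous_neg).tendsto 0).mono_left (nhdsWithin_le_nhds (s := Set.Iio 0))
    simpa [Function.comp_def] using this
  have hFt : Filter.Tendsto (fun t : ℝ => ∫ s in (0:ℝ)..(-t),
      Complex.exp (-(Complex.I * lam * (s : ℂ))) * w ((x₁, s) : ℝ × ℝ))
      (nhdsWithin 0 (Set.Iio 0)) (nhds 0) := by
    have hI : MeasureTheory.IntegrableOn (fun s : ℝ => Complex.exp (-(Complex.I * lam * (s : ℂ))) *
      w ((x₁, s) : ℝ × ℝ)) (Set.uIcc 0 (h/2)) := by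
      rw [Set.uIcc_of_le (by linarith)]
      exact (hf.mono (fun s hs => ⟨hs.1, by linarith [hs.2]⟩)).integrableOn_Icc
    have hc := intervalIntegral.continuousOn_primitive_interval hI 0 Set.left_mem_uIcc
    have hm : nhdsWithin (0:ℝ) (Set.Ico 0 h) ≤ nhdsWithin 0 (Set.uIcc 0 (h/2)) := by
      rw [Set.uIcc_of_le (by linarith)]
      apply nhdsWithin_le_of_mem
      filter_upwards [self_mem_nhdsWithin,
        nhdsWithin_le_nhds (Iio_mem_nhds (show (0:ℝ) < h/2 by linarith))] with s hs hs'
      exact ⟨hs.1, le_of_lt hs'⟩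
    have := (hc.tendsto.mono_left hm).comp hneg
    simpa [Function.comp_def] using this
  have hder : ∀ t ∈ Set.Ioo (-h) 0, pd2 (wext lam w) ((x₁, t) : ℝ × ℝ) =
      -g2 ((x₁, -t) : ℝ × ℝ) + 2 * Complex.I * lam *
       (-(Complex.I * lam) * Complex.exp (-(Complex.I * lam * (t : ℂ))) *
        (∫ s in (0:ℝ)..(-t), Complex.exp (-(Complex.I * lam * (s : ℂ))) * w ((x₁, s) : ℝ × ℝ))
       - Complex.exp (-(Complex.I * lam * (t : ℂ))) *
        (Complex.exp (-(Complex.I * lam * ((-t : ℝ) : ℂ))) * w ((x₁, -t) : ℝ × ℝ))) := by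
    intro t ht
    have hmt : -t ∈ Set.Ioo 0 h := ⟨by linarith [ht.2], by linarith [ht.1]⟩
    have hn : HasDerivAt (fun t : ℝ => -t) (-1) t := hasDerivAt_neg t
    have d1 : HasDerivAt (fun t : ℝ => w ((x₁, -t) : ℝ × ℝ)) ((-1 : ℝ) • g2 (x₁, -t)) t :=
      HasDerivAt.scomp (g₁ := fun s : ℝ => w ((x₁, s) : ℝ × ℝ)) t (hd (x₁, -t) ⟨hx₁, hmt⟩).2 hn
    have hfo := hf.mono Set.Ioo_subset_Ico_self
    have hca := hfo.continuousAt (Ioo_mem_nhds hmt.1 hmt.2)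
    have hii : IntervalIntegrable (fun s : ℝ => Complex.exp (-(Complex.I * lam * (s : ℂ))) *
      w ((x₁, s) : ℝ × ℝ)) MeasureTheory.volume 0 (-t) := by
      apply ContinuousOn.intervalIntegrable
      rw [Set.uIcc_of_le hmt.1.le]
      exact hf.mono (fun s hs => ⟨hs.1, lt_of_le_of_lt hs.2 hmt.2⟩)
    have d2 := intervalIntegral.integral_hasDerivAt_right hii
      (hfo.stronglyMeasurableAtFilter isOpen_Ioo _ hmt) hca
    have d3 := HasDerivAt.scomp t d2 hn
    have d4 : HasDerivAt (fun t : ℝ => Complex.exp (-(Complex.I * lam * (t : ℂ))))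
        (Complex.exp (-(Complex.I * lam * (t : ℂ))) * (-(Complex.I * lam * 1))) t :=
      (((Complex.ofRealCLM.hasDerivAt (x := t)).const_mul (Complex.I * lam)).neg).cexp
    have d5 := d1.add ((d4.const_mul (2 * Complex.I * lam)).mul d3)
    have : HasDerivAt (fun s : ℝ => wext lam w ((x₁, s) : ℝ × ℝ)) _ t := d5
    unfold pd2
    rw [this.deriv]
    simp only [Function.comp_def, Complex.real_smul]
    push_cast
    ring
  have hlim2 : Filter.Tendsto (fun t : ℝ => pd2 (wext lam w) ((x₁, t) : ℝ × ℝ))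
          (nhdsWithin 0 (Set.Iio 0))
          (nhds (-g2 ((x₁, 0) : ℝ × ℝ) - 2 * Complex.I * lam * w ((x₁, 0) : ℝ × ℝ))) := by
    have hl := hGt.neg.add ((((hEt.const_mul (-(Complex.I * lam))).mul hFt).sub
      (hEt.mul (hEt'.mul hWt))).const_mul (2 * Complex.I * lam))
    have hl' := hl.congr' (f₂ := fun t : ℝ => pd2 (wext lam w) ((x₁, t) : ℝ × ℝ)) (by
      filter_upwards [Ioo_mem_nhdsLT (show -h < 0 by linarith)] with t ht
      rw [hder t ht]; rfl)
    convert hl' using 2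
    ring
  refine ⟨?_, hlim2, ?_⟩
  · have hl := hWt.add ((hEt.const_mul (2 * Complex.I * lam)).mul hFt)
    simp only [mul_zero, add_zero] at hl
    exact hl
  · intro hz
    convert hlim2 using 2
    linear_combination 2 * hz
end
end

section
/- Let λ ∈ ℂ and let Ω ⊂ ℝ² be an open connected set symmetric with respect to L = {x₂ = 0} satisfying the column condition: for every (x₁,x₂) ∈ Ω⁺ one has (x₁,0) ∈ L̃ and {(x₁,s) : 0 < s < x₂} ⊂ Ω⁺. Let w be harmonic on Ω⁺, with w, ∂₁w, ∂₂w extending continuously to Ω⁺ ∪ L̃, and ∂₂w + iλw = 0 on L̃. Define w̃ := w on Ω⁺ ∪ L̃ and w̃(x₁,x₂) := w(x₁,−x₂) + 2iλ e^{−iλx₂} ∫₀^{−x₂} e^{−iλs} w(x₁,s) ds for (x₁,x₂) ∈ Ω⁻. Then w̃ is harmonic on Ω. -/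
noncomputable section

open Set

/-- `Ω` is symmetric with respect to the line `L = {x₂ = 0}`. -/
def SymmetricWrtL (Ω : Set (ℝ × ℝ)) : Prop :=
  ∀ x : ℝ × ℝ, x ∈ Ω ↔ ((x.1, -x.2) : ℝ × ℝ) ∈ Ω

/-- `Ω⁺`, the part of `Ω` above the line `L`. -/
def Opos (Ω : Set (ℝ × ℝ)) : Set (ℝ × ℝ) := {x ∈ Ω | 0 < x.2}

/-- `Ω⁻`, the part of `Ω` below the line `L`. -/
def Oneg (Ω : Set (ℝ × ℝ)) : Set (ℝ × ℝ) := {x ∈ Ω | x.2 < 0}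

/-- `L̃ = L ∩ Ω`. -/
def Ltil (Ω : Set (ℝ × ℝ)) : Set (ℝ × ℝ) := {x ∈ Ω | x.2 = 0}

/-- The column condition: for every `x ∈ Ω⁺`, the foot point `(x₁, 0)` belongs to `L̃`
and the whole vertical segment below `x` lies in `Ω⁺`. -/
def ColumnCond (Ω : Set (ℝ × ℝ)) : Prop :=
  ∀ x ∈ Opos Ω, ((x.1, (0:ℝ)) : ℝ × ℝ) ∈ Ltil Ω ∧
    ∀ s : ℝ, 0 < s → s < x.2 → ((x.1, s) : ℝ × ℝ) ∈ Opos Ω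

/-- The reflected function: equal to `w` on `{x₂ ≥ 0}` and to
`w(x₁,-x₂) + 2iλ e^{-iλx₂} ∫₀^{-x₂} e^{-iλs} w(x₁,s) ds` below the line `{x₂ = 0}`. -/
def reflExt (lam : ℂ) (w : ℝ × ℝ → ℂ) (x : ℝ × ℝ) : ℂ :=
  if 0 ≤ x.2 then w x
  else
    w ((x.1, -x.2) : ℝ × ℝ) +
      2 * Complex.I * lam * Complex.exp (-(Complex.I * lam * (x.2 : ℂ))) *
        ∫ s in (0:ℝ)..(-x.2), Complex.exp (-(Complex.I * lam * (s : ℂ))) * w ((x.1, s) : ℝ × ℝ)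

open scoped Interval

lemma pd1_of_hasFDerivAt {f : ℝ × ℝ → ℂ} {x : ℝ × ℝ} {L : ℝ × ℝ →L[ℝ] ℂ}
    (h : HasFDerivAt f L x) : HasDerivAt (fun s : ℝ => f (s, x.2)) (L (1, 0)) x.1 := by
  have h1 : HasDerivAt (fun s : ℝ => ((s, x.2) : ℝ × ℝ)) (1, 0) x.1 :=
    (hasDerivAt_id _).prodMk (hasDerivAt_const _ _)
  exact h.comp_hasDerivAt x.1 h1

lemma pd2_of_hasFDerivAt {f : ℝ × ℝ → ℂ} {x : ℝ × ℝ} {L : ℝ × ℝ →L[ℝ] ℂ}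
    (h : HasFDerivAt f L x) : HasDerivAt (fun s : ℝ => f (x.1, s)) (L (0, 1)) x.2 := by
  have h1 : HasDerivAt (fun s : ℝ => ((x.1, s) : ℝ × ℝ)) (0, 1) x.2 :=
    (hasDerivAt_const _ _).prodMk (hasDerivAt_id _)
  exact h.comp_hasDerivAt x.2 h1

lemma pd1_eq {f : ℝ × ℝ → ℂ} {x : ℝ × ℝ} (h : DifferentiableAt ℝ f x) :
    pd1 f x = fderiv ℝ f x (1, 0) := (pd1_of_hasFDerivAt h.hasFDerivAt).deriv

lemma pd2_eq {f : ℝ × ℝ → ℂ} {x : ℝ × ℝ} (h : DifferentiableAt ℝ f x) :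
    pd2 f x = fderiv ℝ f x (0, 1) := (pd2_of_hasFDerivAt h.hasFDerivAt).deriv

lemma hasDerivAt_pd1 {f : ℝ × ℝ → ℂ} {x : ℝ × ℝ} (h : DifferentiableAt ℝ f x) :
    HasDerivAt (fun s : ℝ => f (s, x.2)) (pd1 f x) x.1 := by
  rw [pd1_eq h]; exact pd1_of_hasFDerivAt h.hasFDerivAt

lemma hasDerivAt_pd2 {f : ℝ × ℝ → ℂ} {x : ℝ × ℝ} (h : DifferentiableAt ℝ f x) :
    HasDerivAt (fun s : ℝ => f (x.1, s)) (pd2 f x) x.2 := by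
  rw [pd2_eq h]; exact pd2_of_hasFDerivAt h.hasFDerivAt

lemma pd1_congr {f g : ℝ × ℝ → ℂ} {U : Set (ℝ × ℝ)} (hU : IsOpen U) (h : EqOn f g U) :
    EqOn (pd1 f) (pd1 g) U := by
  intro x hx
  apply Filter.EventuallyEq.deriv_eq
  have : Filter.Tendsto (fun s : ℝ => ((s, x.2) : ℝ × ℝ)) (nhds x.1) (nhds x) :=
    Continuous.tendsto (by fun_prop) x.1
  filter_upwards [this.eventually (hU.mem_nhds hx)] with s hs using h hs

lemma pd2_congr {f g : ℝ × ℝ → ℂ} {U : Set (ℝ × ℝ)} (hU : IsOpen U) (h : EqOn f g U) :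
    EqOn (pd2 f) (pd2 g) U := by
  intro x hx
  apply Filter.EventuallyEq.deriv_eq
  have : Filter.Tendsto (fun s : ℝ => ((x.1, s) : ℝ × ℝ)) (nhds x.2) (nhds x) :=
    Continuous.tendsto (by fun_prop) x.2
  filter_upwards [this.eventually (hU.mem_nhds hx)] with s hs using h hs

lemma harm_congr {f g : ℝ × ℝ → ℂ} {U : Set (ℝ × ℝ)} (hU : IsOpen U) (h : EqOn f g U)
    (hg : HarmonicOn g U) : HarmonicOn f U := by
  refine ⟨hg.1.congr h, fun x hx => ?_⟩
  rw [pd1_congr hU (pd1_congr hU h) hx, pd2_congr hU (pd2_congr hU h) hx]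
  exact hg.2 x hx

lemma contDiffOn_pd1 {f : ℝ × ℝ → ℂ} {U : Set (ℝ × ℝ)} (hU : IsOpen U)
    (h : ContDiffOn ℝ 2 f U) : ContDiffOn ℝ 1 (pd1 f) U := by
  have := (h.fderiv_of_isOpen (m := 1) hU (by norm_num)).clm_apply
    (contDiffOn_const (c := ((1, 0) : ℝ × ℝ)))
  exact this.congr fun x hx => pd1_eq ((h.differentiableOn (by norm_num)).differentiableAt
    (hU.mem_nhds hx))

lemma contDiffOn_pd2 {f : ℝ × ℝ → ℂ} {U : Set (ℝ × ℝ)} (hU : IsOpen U)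
    (h : ContDiffOn ℝ 2 f U) : ContDiffOn ℝ 1 (pd2 f) U := by
  have := (h.fderiv_of_isOpen (m := 1) hU (by norm_num)).clm_apply
    (contDiffOn_const (c := ((0, 1) : ℝ × ℝ)))
  exact this.congr fun x hx => pd2_eq ((h.differentiableOn (by norm_num)).differentiableAt
    (hU.mem_nhds hx))

lemma diffAt_of {n : WithTop ℕ∞} (hn : n ≠ 0) {f : ℝ × ℝ → ℂ} {U : Set (ℝ × ℝ)} (hU : IsOpen U)
    (h : ContDiffOn ℝ n f U) {x : ℝ × ℝ} (hx : x ∈ U) : DifferentiableAt ℝ f x :=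
  (h.differentiableOn hn).differentiableAt (hU.mem_nhds hx)

lemma pd_symm {f : ℝ × ℝ → ℂ} {U : Set (ℝ × ℝ)} (hU : IsOpen U)
    (h : ContDiffOn ℝ 2 f U) {x : ℝ × ℝ} (hx : x ∈ U) : pd1 (pd2 f) x = pd2 (pd1 f) x := by
  have hd : DifferentiableAt ℝ (fderiv ℝ f) x :=
    ((h.fderiv_of_isOpen (m := 1) hU (by norm_num)).differentiableOn (by norm_num)).differentiableAt
      (hU.mem_nhds hx)
  have e1 : EqOn (pd1 f) (fun y => fderiv ℝ f y (1, 0)) U := fun y hy =>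
    pd1_eq (diffAt_of (by norm_num) hU h hy)
  have e2 : EqOn (pd2 f) (fun y => fderiv ℝ f y (0, 1)) U := fun y hy =>
    pd2_eq (diffAt_of (by norm_num) hU h hy)
  rw [pd1_congr hU e2 hx, pd2_congr hU e1 hx, pd1_eq (by fun_prop), pd2_eq (by fun_prop)]
  rw [fderiv_clm_apply hd (by fun_prop), fderiv_clm_apply hd (by fun_prop)]
  have := (h.contDiffAt (hU.mem_nhds hx)).isSymmSndFDerivAt (by simp)
  simpa using this.eq (1, 0) (0, 1)

lemma harm_lin {f g : ℝ × ℝ → ℂ} {U : Set (ℝ × ℝ)} (hU : IsOpen U) (c : ℂ)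
    (hf : HarmonicOn f U) (hg : HarmonicOn g U) : HarmonicOn (fun x => f x + c * g x) U := by
  have h1 : EqOn (pd1 (fun x => f x + c * g x)) (fun x => pd1 f x + c * pd1 g x) U := fun x hx =>
    ((hasDerivAt_pd1 (diffAt_of (by norm_num) hU hf.1 hx)).add
      ((hasDerivAt_pd1 (diffAt_of (by norm_num) hU hg.1 hx)).const_mul c)).deriv
  have h2 : EqOn (pd2 (fun x => f x + c * g x)) (fun x => pd2 f x + c * pd2 g x) U := fun x hx =>
    ((hasDerivAt_pd2 (diffAt_of (by norm_num) hU hf.1 hx)).add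
      ((hasDerivAt_pd2 (diffAt_of (by norm_num) hU hg.1 hx)).const_mul c)).deriv
  refine ⟨hf.1.add (contDiffOn_const.mul hg.1), fun x hx => ?_⟩
  rw [pd1_congr hU h1 hx, pd2_congr hU h2 hx]
  have h3 : pd1 (fun x => pd1 f x + c * pd1 g x) x = pd1 (pd1 f) x + c * pd1 (pd1 g) x :=
    ((hasDerivAt_pd1 (diffAt_of (by norm_num) hU (contDiffOn_pd1 hU hf.1) hx)).add
      ((hasDerivAt_pd1 (diffAt_of (by norm_num) hU (contDiffOn_pd1 hU hg.1) hx)).const_mul c)).deriv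
  have h4 : pd2 (fun x => pd2 f x + c * pd2 g x) x = pd2 (pd2 f) x + c * pd2 (pd2 g) x :=
    ((hasDerivAt_pd2 (diffAt_of (by norm_num) hU (contDiffOn_pd2 hU hf.1) hx)).add
      ((hasDerivAt_pd2 (diffAt_of (by norm_num) hU (contDiffOn_pd2 hU hg.1) hx)).const_mul c)).deriv
  rw [h3, h4]
  linear_combination hf.2 x hx + c * hg.2 x hx

lemma CR_plus {g : ℝ × ℝ → ℂ} {z : ℂ} (hd : DifferentiableAt ℝ g (z.re, z.im))
    (h : pd2 g (z.re, z.im) = Complex.I * pd1 g (z.re, z.im)) :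
    HasDerivAt (fun z : ℂ => g (z.re, z.im)) (pd1 g (z.re, z.im)) z := by
  have h1 : HasFDerivAt (fun z : ℂ => ((z.re, z.im) : ℝ × ℝ))
      (Complex.reCLM.prod Complex.imCLM) z := (Complex.reCLM.prod Complex.imCLM).hasFDerivAt
  have h2 := HasFDerivAt.comp z hd.hasFDerivAt h1
  rw [hasDerivAt_iff_hasFDerivAt]
  refine hasFDerivAt_of_restrictScalars ℝ h2 ?_
  rw [pd1_eq hd, pd2_eq hd] at h
  ext v
  have e : ((v.re, v.im) : ℝ × ℝ) = v.re • ((1, 0) : ℝ × ℝ) + v.im • ((0, 1) : ℝ × ℝ) := by simp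
  have : (fderiv ℝ g (z.re, z.im)) (v.re, v.im) =
      v * (fderiv ℝ g (z.re, z.im)) (1, 0) := by
    rw [e, map_add, map_smul, map_smul, h]
    nth_rewrite 3 [← Complex.re_add_im v]
    simp only [Complex.real_smul]
    ring
  simp [this, pd1_eq hd]

lemma CR_minus {g : ℝ × ℝ → ℂ} {z : ℂ} (hd : DifferentiableAt ℝ g (z.re, -z.im))
    (h : pd2 g (z.re, -z.im) = -Complex.I * pd1 g (z.re, -z.im)) :
    HasDerivAt (fun z : ℂ => g (z.re, -z.im)) (pd1 g (z.re, -z.im)) z := by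
  have h1 : HasFDerivAt (fun z : ℂ => ((z.re, -z.im) : ℝ × ℝ))
      (Complex.reCLM.prod (-Complex.imCLM)) z := (Complex.reCLM.prod (-Complex.imCLM)).hasFDerivAt
  have h2 := HasFDerivAt.comp z hd.hasFDerivAt h1
  rw [hasDerivAt_iff_hasFDerivAt]
  refine hasFDerivAt_of_restrictScalars ℝ h2 ?_
  rw [pd1_eq hd, pd2_eq hd] at h
  ext v
  have e : ((v.re, -v.im) : ℝ × ℝ) = v.re • ((1, 0) : ℝ × ℝ) + (-v.im) • ((0, 1) : ℝ × ℝ) := by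
    simp
  have : (fderiv ℝ g (z.re, -z.im)) (v.re, -v.im) =
      v * (fderiv ℝ g (z.re, -z.im)) (1, 0) := by
    rw [e, map_add, map_smul, map_smul, h]
    nth_rewrite 3 [← Complex.re_add_im v]
    simp only [Complex.real_smul]
    push_cast
    ring
  simp [this, pd1_eq hd]

lemma painleve {S : Set ℂ} (hS : IsOpen S) {Φ : ℂ → ℂ} (hc : ContinuousOn Φ S)
    (hd : ∀ z ∈ S, z.im ≠ 0 → DifferentiableAt ℂ Φ z) : DifferentiableOn ℂ Φ S := by
  rw [← Complex.isConservativeOn_and_continuousOn_iff_isDifferentiableOn hS]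
  refine ⟨fun z w hzw => ?_, hc⟩
  rw [← add_eq_zero_iff_eq_neg, Complex.wedgeIntegral_add_wedgeIntegral_eq]
  have hzw' : [[z.re, w.re]] ×ℂ [[z.im, w.im]] ⊆ S := hzw
  have key : ∀ a b : ℝ, [[a, b]] ⊆ [[z.im, w.im]] → (0 : ℝ) ∉ Ioo (min a b) (max a b) →
      (∫ x : ℝ in z.re..w.re, Φ (x + a * Complex.I)) -
      (∫ x : ℝ in z.re..w.re, Φ (x + b * Complex.I)) +
      Complex.I • (∫ y : ℝ in a..b, Φ (w.re + y * Complex.I)) -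
      Complex.I • (∫ y : ℝ in a..b, Φ (z.re + y * Complex.I)) = 0 := by
    intro a b hab h0
    have hsub : [[z.re, w.re]] ×ℂ [[a, b]] ⊆ S := fun x hx => hzw' ⟨hx.1, hab hx.2⟩
    have := Complex.integral_boundary_rect_eq_zero_of_continuousOn_of_differentiableOn Φ
      ⟨z.re, a⟩ ⟨w.re, b⟩ (hc.mono hsub) (fun x hx => by
        refine (hd x (hsub ⟨Ioo_subset_Icc_self hx.1, Ioo_subset_Icc_self hx.2⟩) ?_).differentiableWithinAt
        intro h
        apply h0
        have := hx.2
        simp only [mem_preimage, h] at this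
        exact this)
    exact this
  by_cases h0 : (0 : ℝ) ∈ Ioo (min z.im w.im) (max z.im w.im)
  · have h0' : (0 : ℝ) ∈ [[z.im, w.im]] := Ioo_subset_Icc_self h0
    have k1 := key z.im 0 (uIcc_subset_uIcc left_mem_uIcc h0') (fun h => by
      rcases le_total z.im 0 with h' | h' <;> simp [h'] at h)
    have k2 := key 0 w.im (uIcc_subset_uIcc h0' right_mem_uIcc) (fun h => by
      rcases le_total w.im 0 with h' | h' <;> simp [h'] at h)
    have hi : ∀ c ∈ [[z.re, w.re]], ∀ a ∈ [[z.im, w.im]], ∀ b ∈ [[z.im, w.im]],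
        IntervalIntegrable (fun y : ℝ => Φ (c + y * Complex.I)) MeasureTheory.volume a b := by
      intro c hc' a ha b hb
      apply ContinuousOn.intervalIntegrable
      refine hc.comp (Continuous.continuousOn (by fun_prop)) (fun y hy => hzw' ?_)
      refine ⟨?_, ?_⟩
      · simpa using hc'
      · simpa using uIcc_subset_uIcc ha hb hy
    have a1 := intervalIntegral.integral_add_adjacent_intervals
      (hi w.re right_mem_uIcc z.im left_mem_uIcc 0 h0') (hi w.re right_mem_uIcc 0 h0' w.im right_mem_uIcc)
    have a2 := intervalIntegral.integral_add_adjacent_intervals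
      (hi z.re left_mem_uIcc z.im left_mem_uIcc 0 h0') (hi z.re left_mem_uIcc 0 h0' w.im right_mem_uIcc)
    rw [← a1, ← a2]
    simp only [smul_eq_mul] at k1 k2 ⊢
    linear_combination k1 + k2
  · exact key _ _ subset_rfl h0

lemma pd1_hol {g : ℂ → ℂ} {T : Set ℂ} (hT : IsOpen T) (hg : DifferentiableOn ℂ g T) (σ : ℝ) :
    EqOn (pd1 (fun x => g (x.1 + σ * x.2 * Complex.I)))
      (fun x => deriv g (x.1 + σ * x.2 * Complex.I))
      {x : ℝ × ℝ | (x.1 + σ * x.2 * Complex.I : ℂ) ∈ T} := by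
  intro x hx
  have h0 := (hg.differentiableAt (hT.mem_nhds hx)).hasDerivAt
  have h1 : HasDerivAt (fun s : ℝ => (s + σ * x.2 * Complex.I : ℂ)) 1 x.1 :=
    (Complex.ofRealCLM.hasDerivAt (x := x.1)).add_const _
  have := (h0.comp x.1 h1).deriv
  rw [mul_one] at this
  exact this

lemma pd2_hol {g : ℂ → ℂ} {T : Set ℂ} (hT : IsOpen T) (hg : DifferentiableOn ℂ g T) (σ : ℝ) :
    EqOn (pd2 (fun x => g (x.1 + σ * x.2 * Complex.I)))
      (fun x => (σ * Complex.I) * deriv g (x.1 + σ * x.2 * Complex.I))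
      {x : ℝ × ℝ | (x.1 + σ * x.2 * Complex.I : ℂ) ∈ T} := by
  intro x hx
  have h0 := (hg.differentiableAt (hT.mem_nhds hx)).hasDerivAt
  have h1 : HasDerivAt (fun s : ℝ => (x.1 + σ * s * Complex.I : ℂ)) (σ * 1 * Complex.I) x.2 :=
    (((Complex.ofRealCLM.hasDerivAt (x := x.2)).const_mul _).mul_const _).const_add _
  have := (h0.comp x.2 h1).deriv
  rw [mul_comm, mul_one] at this
  exact this

lemma harm_plus {g : ℂ → ℂ} {T : Set ℂ} (hT : IsOpen T) (hg : DifferentiableOn ℂ g T) (σ : ℝ)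
    (hσ : σ ^ 2 = 1) :
    HarmonicOn (fun x => g (x.1 + σ * x.2 * Complex.I))
      {x : ℝ × ℝ | (x.1 + σ * x.2 * Complex.I : ℂ) ∈ T} := by
  have hop : IsOpen {x : ℝ × ℝ | (x.1 + σ * x.2 * Complex.I : ℂ) ∈ T} :=
    hT.preimage (by fun_prop)
  have hg' : DifferentiableOn ℂ (deriv g) T := hg.deriv hT
  refine ⟨?_, fun x hx => ?_⟩
  · have h1 : ContDiffOn ℝ 2 g T := (hg.contDiffOn hT).restrict_scalars ℝ
    refine h1.comp (g := g) (f := fun x : ℝ × ℝ => (x.1 + σ * x.2 * Complex.I : ℂ)) ?_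
      (fun x hx => hx)
    apply ContDiff.contDiffOn
    have a1 : ContDiff ℝ 2 (fun x : ℝ × ℝ => (x.1 : ℂ)) :=
      Complex.ofRealCLM.contDiff.comp contDiff_fst
    have a2 : ContDiff ℝ 2 (fun x : ℝ × ℝ => (x.2 : ℂ)) :=
      Complex.ofRealCLM.contDiff.comp contDiff_snd
    exact a1.add ((contDiff_const.mul a2).mul contDiff_const)
  · rw [pd1_congr hop (pd1_hol hT hg σ) hx, pd1_hol hT hg' σ hx, pd2_congr hop (pd2_hol hT hg σ) hx]
    have hg'' : DifferentiableOn ℂ (fun z => (σ * Complex.I) * deriv g z) T := hg'.const_mul _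
    rw [pd2_hol hT hg'' σ hx]
    simp only
    rw [deriv_const_mul _ (hg'.differentiableAt (hT.mem_nhds hx))]
    have : (σ : ℂ) ^ 2 = 1 := by exact_mod_cast hσ
    linear_combination (deriv (deriv g) (x.1 + σ * x.2 * Complex.I)) *
      (Complex.I ^ 2 * this + Complex.I_sq)

lemma harm_CR {w : ℝ × ℝ → ℂ} {U : Set (ℝ × ℝ)} (hU : IsOpen U) (hw : HarmonicOn w U) {a : ℂ}
    (ha : a ^ 2 = -1) {m : ℝ × ℝ → ℂ} (hm : EqOn m (fun x => (pd1 w x + a * pd2 w x) / 2) U)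
    {x : ℝ × ℝ} (hx : x ∈ U) : DifferentiableAt ℝ m x ∧ pd2 m x = -a * pd1 m x := by
  have c1 := contDiffOn_pd1 hU hw.1
  have c2 := contDiffOn_pd2 hU hw.1
  have d1 := diffAt_of (by norm_num) hU c1 hx
  have d2 := diffAt_of (by norm_num) hU c2 hx
  refine ⟨?_, ?_⟩
  · have : DifferentiableAt ℝ (fun x => (pd1 w x + a * pd2 w x) / 2) x := by fun_prop
    exact this.congr_of_eventuallyEq (hm.eventuallyEq_of_mem (hU.mem_nhds hx))
  · rw [pd1_congr hU hm hx, pd2_congr hU hm hx]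
    have e1 : pd1 (fun x => (pd1 w x + a * pd2 w x) / 2) x =
        (pd1 (pd1 w) x + a * pd1 (pd2 w) x) / 2 :=
      (((hasDerivAt_pd1 d1).add ((hasDerivAt_pd1 d2).const_mul a)).div_const 2).deriv
    have e2 : pd2 (fun x => (pd1 w x + a * pd2 w x) / 2) x =
        (pd2 (pd1 w) x + a * pd2 (pd2 w) x) / 2 :=
      (((hasDerivAt_pd2 d1).add ((hasDerivAt_pd2 d2).const_mul a)).div_const 2).deriv
    rw [e1, e2, ← pd_symm hU hw.1 hx]
    linear_combination (a / 2) * hw.2 x hx + (pd1 (pd2 w) x) / 2 * ha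

lemma ode_lemma (lam : ℂ) {b : ℝ} (u u' v v' h : ℝ → ℂ) (hu : ContinuousOn u (Icc 0 b))
    (hu' : ∀ t ∈ Ioo 0 b, HasDerivAt u (u' t) t) (hv' : ∀ t ∈ Ioo (-b) b, HasDerivAt v (v' t) t)
    (h1 : ∀ t ∈ Ioo 0 b, u' t + Complex.I * lam * u t = h t)
    (h2 : ∀ t ∈ Ioo (-b) b, v' t + Complex.I * lam * v t = h t)
    (hodd : ∀ t, h (-t) = - h t) {a y : ℝ} (ha : a ∈ Ioo (-b) b) (hy : y ∈ Ioo (-b) b) 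
    (U : ℝ → ℂ) (hU : U = fun y : ℝ => if 0 ≤ y then u y else u (-y) + 2 * Complex.I * lam *
      Complex.exp (-(Complex.I * lam * (y : ℂ))) *
        ∫ s in (0:ℝ)..(-y), Complex.exp (-(Complex.I * lam * (s : ℂ))) * u s) :
    Complex.exp (Complex.I * lam * y) * (U y - v y) =
      Complex.exp (Complex.I * lam * a) * (U a - v a) := by
  wlog hay : a ≤ y generalizing a y
  · exact (this hy ha (le_of_not_ge hay)).symm
  have hb : 0 ≤ b := by have := ha.1.trans ha.2; linarith
  set e : ℝ → ℂ := fun s => Complex.exp (-(Complex.I * lam * (s : ℂ))) * u s with he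
  have hec : ContinuousOn e (Icc 0 b) :=
    ContinuousOn.mul (Continuous.continuousOn (by fun_prop)) hu
  set J : ℝ → ℂ := fun t => ∫ s in (0:ℝ)..t, e s with hJ
  have hJc : ContinuousOn J (Icc 0 b) := by
    have := intervalIntegral.continuousOn_primitive_interval (μ := MeasureTheory.volume)
      (a := 0) (b := b) (f := e) (by rw [uIcc_of_le hb]; exact hec.integrableOn_Icc)
    rwa [uIcc_of_le hb] at this
  have hJd : ∀ t ∈ Ioo 0 b, HasDerivAt J (e t) t := by
    intro t ht
    apply intervalIntegral.integral_hasDerivAt_right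
    · apply ContinuousOn.intervalIntegrable
      rw [uIcc_of_le ht.1.le]
      exact hec.mono (Icc_subset_Icc_right ht.2.le)
    · exact (hec.mono Ioo_subset_Icc_self).stronglyMeasurableAtFilter isOpen_Ioo t ht
    · exact hec.continuousAt (Icc_mem_nhds ht.1 ht.2)
  have hUd : ∀ t ∈ Ioo (-b) b, t ≠ 0 → HasDerivAt U (h t - Complex.I * lam * U t) t := by
    intro t ht ht0
    rcases lt_or_gt_of_ne ht0 with htn | htp
    · have hmt : -t ∈ Ioo 0 b := ⟨by linarith, by linarith [ht.1]⟩
      have hneg : HasDerivAt (fun y : ℝ => -y) (-1) t := hasDerivAt_neg t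
      have k1 := (hu' (-t) hmt).scomp t hneg
      have k2 := (hJd (-t) hmt).scomp t hneg
      have k3 : HasDerivAt (fun y : ℝ => Complex.exp (-(Complex.I * lam * (y : ℂ))))
          (Complex.exp (-(Complex.I * lam * (t : ℂ))) * -(Complex.I * lam * 1)) t :=
        (((Complex.ofRealCLM.hasDerivAt (x := t)).const_mul (Complex.I * lam)).neg).cexp
      have k4 := k1.add ((k3.const_mul (2 * Complex.I * lam)).mul k2)
      have hEq : U =ᶠ[nhds t] fun y => (u ∘ fun y => -y) y + (2 * Complex.I * lam *
          Complex.exp (-(Complex.I * lam * (y : ℂ)))) * (J ∘ fun y => -y) y := by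
        filter_upwards [Iio_mem_nhds htn] with y hy
        rw [hU]
        simp only [if_neg (not_le.mpr (mem_Iio.mp hy))]
        rfl
      have hUt := hEq.self_of_nhds
      refine (k4.congr_of_eventuallyEq hEq).congr_deriv ?_
      have q1 := h1 (-t) hmt
      rw [hodd] at q1
      rw [hUt]
      have q2 : Complex.exp (-(Complex.I * lam * (t : ℂ))) *
          Complex.exp (-(Complex.I * lam * ((-t : ℝ) : ℂ))) = 1 := by
        rw [← Complex.exp_add]; simp
      simp only [Function.comp, he, neg_smul, one_smul]
      linear_combination -q1 - 2 * Complex.I * lam * u (-t) * q2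
    · have hmt : t ∈ Ioo 0 b := ⟨htp, ht.2⟩
      have hEq : U =ᶠ[nhds t] u := by
        filter_upwards [Ioi_mem_nhds htp] with y hy
        rw [hU]
        simp only [if_pos (le_of_lt (mem_Ioi.mp hy))]
      rw [hEq.self_of_nhds]
      refine ((hu' t hmt).congr_of_eventuallyEq hEq).congr_deriv ?_
      linear_combination h1 t hmt
  have hUc : ContinuousOn U (Ioo (-b) b) := by
    rw [hU]
    apply ContinuousOn.if
    · intro t ht
      have : t = 0 := by
        have h := ht.2
        have e : {a : ℝ | 0 ≤ a} = Ici 0 := rfl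
        rw [e, frontier_Ici] at h
        exact h
      subst this
      simp
    · refine hu.mono ?_
      rintro t ⟨ht, ht'⟩
      have e : {a : ℝ | 0 ≤ a} = Ici 0 := rfl
      rw [e, closure_Ici] at ht'
      exact ⟨ht', ht.2.le⟩
    · have hm : MapsTo (fun t : ℝ => -t) (Ioo (-b) b ∩ closure {a : ℝ | ¬ 0 ≤ a}) (Icc 0 b) := by
        rintro t ⟨ht, ht'⟩
        have e : {a : ℝ | ¬ 0 ≤ a} = Iio 0 := by ext; simp
        rw [e, closure_Iio] at ht'
        have := ht.1
        have ht'' : t ≤ 0 := ht'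
        exact ⟨by linarith, by linarith⟩
      exact (hu.comp continuousOn_neg hm).add ((Continuous.continuousOn (by fun_prop)).mul
        (hJc.comp continuousOn_neg hm))
  have hsub : Icc a y ⊆ Ioo (-b) b := fun t ht => ⟨ha.1.trans_le ht.1, ht.2.trans_lt hy.2⟩
  have hvc : ContinuousOn v (Ioo (-b) b) := fun t ht => (hv' t ht).continuousAt.continuousWithinAt
  have := MeasureTheory.integral_eq_of_hasDerivAt_off_countable_of_le
    (fun t : ℝ => Complex.exp (Complex.I * lam * t) * (U t - v t)) (fun _ => 0) hay
    (s := {0}) (countable_singleton 0)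
    (ContinuousOn.mul (Continuous.continuousOn (by fun_prop)) ((hUc.mono hsub).sub (hvc.mono hsub)))
    (by
      rintro t ⟨ht, ht0⟩
      have ht' := hsub (Ioo_subset_Icc_self ht)
      have k3 : HasDerivAt (fun y : ℝ => Complex.exp (Complex.I * lam * (y : ℂ)))
          (Complex.exp (Complex.I * lam * (t : ℂ)) * (Complex.I * lam * 1)) t :=
        ((Complex.ofRealCLM.hasDerivAt (x := t)).const_mul (Complex.I * lam)).cexp
      refine (k3.mul ((hUd t ht' ht0).sub (hv' t ht'))).congr_deriv ?_
      simp only [Pi.sub_apply]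
      linear_combination (-Complex.exp (Complex.I * lam * (t : ℂ))) * h2 t ht')
    (by simp)
  simp only [intervalIntegral.integral_zero] at this
  exact (sub_eq_zero.mp this.symm)

lemma convex_rect (a b c d : ℝ) : Convex ℝ (Ioo a b ×ℂ Ioo c d) :=
  ((convex_Ioo a b).linear_preimage Complex.reLm).inter
    ((convex_Ioo c d).linear_preimage Complex.imLm)

lemma core1 (lam : ℂ) {c δ b : ℝ} (w g1 g2 : ℝ × ℝ → ℂ)
    (hw : HarmonicOn w (Ioo (c - δ) (c + δ) ×ˢ Ioo 0 b))
    (hwc : ContinuousOn w (Icc (c - δ) (c + δ) ×ˢ Icc 0 b))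
    (hg : ∀ x ∈ Ioo (c - δ) (c + δ) ×ˢ Ioo 0 b, g1 x = pd1 w x ∧ g2 x = pd2 w x)
    (hg1 : ContinuousOn g1 (Icc (c - δ) (c + δ) ×ˢ Icc 0 b))
    (hg2 : ContinuousOn g2 (Icc (c - δ) (c + δ) ×ˢ Icc 0 b))
    (hbc : ∀ t ∈ Ioo (c - δ) (c + δ), g2 (t, 0) + Complex.I * lam * w (t, 0) = 0) :
    ∃ Φ : ℂ → ℂ, DifferentiableOn ℂ Φ (Ioo (c - δ) (c + δ) ×ℂ Ioo (-b) b) ∧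
      ∀ x ∈ Ioo (c - δ) (c + δ) ×ˢ Ioo 0 b, pd2 w x + Complex.I * lam * w x =
        Φ (x.1 + (1 : ℝ) * x.2 * Complex.I) - Φ (x.1 + (-1 : ℝ) * x.2 * Complex.I) := by
  set R : Set (ℝ × ℝ) := Ioo (c - δ) (c + δ) ×ˢ Ioo 0 b with hR
  set K : Set (ℝ × ℝ) := Icc (c - δ) (c + δ) ×ˢ Icc 0 b with hK
  have hRo : IsOpen R := isOpen_Ioo.prod isOpen_Ioo
  have hKc : IsCompact K := isCompact_Icc.prod isCompact_Icc
  have hRK : R ⊆ K := prod_mono Ioo_subset_Icc_self Ioo_subset_Icc_self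
  set Sp : Set ℂ := Ioo (c - δ) (c + δ) ×ℂ Ioo 0 b with hSp
  have hSpo : IsOpen Sp := isOpen_Ioo.reProdIm isOpen_Ioo
  have hSpc : Convex ℝ Sp := convex_rect _ _ _ _
  set f : ℝ × ℝ → ℂ := fun p => (g1 p + (-Complex.I) * g2 p) / 2 with hf
  set k : ℝ × ℝ → ℂ := fun p => (g1 p + Complex.I * g2 p) / 2 with hk
  have hfc : ContinuousOn f K := (hg1.add (continuousOn_const.mul hg2)).div_const 2
  have hkc : ContinuousOn k K := (hg1.add (continuousOn_const.mul hg2)).div_const 2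
  have hfe : EqOn f (fun x => (pd1 w x + (-Complex.I) * pd2 w x) / 2) R := fun x hx => by
    simp only [hf, (hg x hx).1, (hg x hx).2]
  have hke : EqOn k (fun x => (pd1 w x + Complex.I * pd2 w x) / 2) R := fun x hx => by
    simp only [hk, (hg x hx).1, (hg x hx).2]
  have hfd : ∀ z ∈ Sp, DifferentiableAt ℂ (fun z : ℂ => f (z.re, z.im)) z := by
    intro z hz
    have hx : ((z.re, z.im) : ℝ × ℝ) ∈ R := ⟨hz.1, hz.2⟩
    obtain ⟨d, e⟩ := harm_CR hRo hw (by simp) hfe hx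
    exact (CR_plus d (by rw [e, neg_neg])).differentiableAt
  have hkd : ∀ z : ℂ, (z.re, -z.im) ∈ R →
      DifferentiableAt ℂ (fun z : ℂ => k (z.re, -z.im)) z := by
    intro z hx
    obtain ⟨d, e⟩ := harm_CR hRo hw (by simp) hke hx
    exact (CR_minus d e).differentiableAt
  obtain ⟨A, hAc, hAd⟩ : ∃ A : ℂ → ℂ, Continuous A ∧
      ∀ z ∈ Sp, HasDerivAt A (f (z.re, z.im)) z := by
    obtain ⟨A, hA⟩ := hSpc.exists_forall_hasDerivWithinAt
      (fun z hz => (hfd z hz).differentiableWithinAt)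
    obtain ⟨M, hM⟩ := hKc.exists_bound_of_continuousOn hfc
    have hL := hSpc.lipschitzOnWith_of_nnnorm_hasDerivWithin_le (C := M.toNNReal) hA (fun z hz => by
      have := hM (z.re, z.im) (hRK ⟨hz.1, hz.2⟩)
      rw [← NNReal.coe_le_coe]
      exact this.trans (Real.le_coe_toNNReal M))
    obtain ⟨A', hA', hAA⟩ := hL.extend_finite_dimension
    refine ⟨A', hA'.continuous, fun z hz => ?_⟩
    exact ((hA z hz).hasDerivAt (hSpo.mem_nhds hz)).congr_of_eventuallyEq
      ((hAA.symm.eventuallyEq_of_mem (hSpo.mem_nhds hz)))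
  have hAdiff : DifferentiableOn ℂ A Sp := fun z hz =>
    (hAd z hz).differentiableAt.differentiableWithinAt
  set a : ℝ × ℝ → ℂ := fun p => A (p.1 + (1 : ℝ) * p.2 * Complex.I) with ha
  have hac : Continuous a := by fun_prop
  have hmem : ∀ p ∈ R, (p.1 + (1 : ℝ) * p.2 * Complex.I : ℂ) ∈ Sp := fun p hp =>
    ⟨by simpa using hp.1, by simpa using hp.2⟩
  set D : ℝ × ℝ → ℂ := fun p => w p - a p with hD
  have hDc : ContinuousOn D K := hwc.sub hac.continuousOn
  have hDd : ∀ z : ℂ, (z.re, -z.im) ∈ R →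
      DifferentiableAt ℂ (fun z : ℂ => D (z.re, -z.im)) z := by
    intro z hx
    have dw := diffAt_of (by norm_num) hRo hw.1 hx
    have da : DifferentiableAt ℝ a (z.re, -z.im) := by
      have h1 := (harm_plus hSpo hAdiff 1 (by norm_num)).1
      exact diffAt_of (n := 2) (by norm_num) (hSpo.preimage (by fun_prop)) h1 (hmem _ hx)
    have dv : deriv A ((z.re : ℂ) + (1 : ℝ) * ((-z.im : ℝ) : ℂ) * Complex.I) = f (z.re, -z.im) := by
      rw [(hAd _ (hmem _ hx)).deriv]
      simp
    have e1 : pd1 D (z.re, -z.im) = k (z.re, -z.im) := by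
      have h0 := pd1_hol hSpo hAdiff 1 (hmem _ hx)
      have h1 : pd1 D (z.re, -z.im) = pd1 w (z.re, -z.im) - pd1 a (z.re, -z.im) :=
        ((hasDerivAt_pd1 dw).sub (hasDerivAt_pd1 da)).deriv
      rw [h1, ha, h0]
      simp only
      rw [dv, hfe hx, hke hx]
      ring
    have e2 : pd2 D (z.re, -z.im) = -Complex.I * k (z.re, -z.im) := by
      have h0 := pd2_hol hSpo hAdiff 1 (hmem _ hx)
      have h1 : pd2 D (z.re, -z.im) = pd2 w (z.re, -z.im) - pd2 a (z.re, -z.im) :=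
        ((hasDerivAt_pd2 dw).sub (hasDerivAt_pd2 da)).deriv
      rw [h1, ha, h0]
      simp only
      rw [dv, hfe hx, hke hx]
      push_cast
      linear_combination (pd2 w (z.re, -z.im)) * Complex.I_sq
    have dD : DifferentiableAt ℝ D (z.re, -z.im) := dw.sub da
    exact (CR_minus dD (by rw [e1, e2])).differentiableAt
  set Φ : ℂ → ℂ := fun z => if 0 ≤ z.im then Complex.I * f (z.re, z.im) + Complex.I * lam * A z
    else Complex.I * k (z.re, -z.im) - Complex.I * lam * D (z.re, -z.im) with hΦ
  refine ⟨Φ, painleve (isOpen_Ioo.reProdIm isOpen_Ioo) ?_ ?_, ?_⟩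
  · apply ContinuousOn.if
    · rintro z ⟨hz, hz'⟩
      have h0 : z.im = 0 := by
        rw [Complex.frontier_setOfPred_le_im] at hz'
        exact hz'
      have hb := hbc z.re hz.1
      have hzz : (z.re : ℂ) = z := by apply Complex.ext <;> simp [h0]
      simp only [hf, hk, hD, ha, h0, neg_zero]
      simp only [Complex.ofReal_zero, mul_zero, zero_mul, add_zero, hzz]
      linear_combination hb - g2 (z.re, 0) * Complex.I_sq
    · have hm : MapsTo (fun z : ℂ => ((z.re, z.im) : ℝ × ℝ))
          (Ioo (c - δ) (c + δ) ×ℂ Ioo (-b) b ∩ closure {a : ℂ | 0 ≤ a.im}) K := by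
        rintro z ⟨hz, hz'⟩
        rw [(isClosed_le continuous_const Complex.continuous_im).closure_eq] at hz'
        exact ⟨Ioo_subset_Icc_self hz.1, hz', hz.2.2.le⟩
      exact (continuousOn_const.mul (hfc.comp (Continuous.continuousOn (by fun_prop)) hm)).add
        (Continuous.continuousOn (by fun_prop))
    · have hm : MapsTo (fun z : ℂ => ((z.re, -z.im) : ℝ × ℝ))
          (Ioo (c - δ) (c + δ) ×ℂ Ioo (-b) b ∩ closure {a : ℂ | ¬ 0 ≤ a.im}) K := by
        rintro z ⟨hz, hz'⟩
        have e : {a : ℂ | ¬ 0 ≤ a.im} = {a : ℂ | a.im < 0} := by ext; simp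
        rw [e, Complex.closure_setOfPred_im_lt] at hz'
        have h1 := hz.2.1
        have h2 : z.im ≤ 0 := hz'
        exact ⟨Ioo_subset_Icc_self hz.1, by simpa using h2, by simp only; linarith⟩
      exact (continuousOn_const.mul (hkc.comp (Continuous.continuousOn (by fun_prop)) hm)).sub
        (continuousOn_const.mul (hDc.comp (Continuous.continuousOn (by fun_prop)) hm))
  · intro z hz h0
    rcases lt_or_gt_of_ne h0 with hn | hp
    · have hx : ((z.re, -z.im) : ℝ × ℝ) ∈ R :=
        ⟨hz.1, by simpa using hn, by have := hz.2.1; simp only; linarith⟩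
      have hEq : Φ =ᶠ[nhds z] fun z =>
          Complex.I * k (z.re, -z.im) - Complex.I * lam * D (z.re, -z.im) := by
        filter_upwards [(isOpen_lt Complex.continuous_im continuous_const).mem_nhds hn] with y hy
        simp only [hΦ]
        rw [if_neg (not_le.mpr hy)]
      exact (((hkd z hx).const_mul _).sub ((hDd z hx).const_mul _)).congr_of_eventuallyEq hEq
    · have hx : z ∈ Sp := ⟨hz.1, hp, hz.2.2⟩
      have hEq : Φ =ᶠ[nhds z] fun z =>
          Complex.I * f (z.re, z.im) + Complex.I * lam * A z := by
        filter_upwards [(isOpen_lt continuous_const Complex.continuous_im).mem_nhds hp] with y hy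
        simp only [hΦ]
        rw [if_pos (le_of_lt hy)]
      exact (((hfd z hx).const_mul _).add ((hAd z hx).differentiableAt.const_mul _)).congr_of_eventuallyEq hEq
  · intro x hx
    have hp : 0 < x.2 := hx.2.1
    have i1 : (x.1 + (1 : ℝ) * x.2 * Complex.I : ℂ).im = x.2 := by simp
    have i2 : (x.1 + (1 : ℝ) * x.2 * Complex.I : ℂ).re = x.1 := by simp
    have j1 : (x.1 + (-1 : ℝ) * x.2 * Complex.I : ℂ).im = -x.2 := by simp
    have j2 : (x.1 + (-1 : ℝ) * x.2 * Complex.I : ℂ).re = x.1 := by simp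
    simp only [hΦ]
    rw [i1, i2, j1, j2, if_pos hp.le, if_neg (by linarith), neg_neg]
    simp only [hf, hk, hD, ha, (hg x hx).1, (hg x hx).2]
    linear_combination (pd2 w x) * Complex.I_sq

lemma core2 (lam : ℂ) {c δ b : ℝ} {Φ : ℂ → ℂ}
    (hΦ : DifferentiableOn ℂ Φ (Ioo (c - δ) (c + δ) ×ℂ Ioo (-b) b)) :
    ∃ V : ℝ × ℝ → ℂ, HarmonicOn V (Ioo (c - δ) (c + δ) ×ˢ Ioo (-b) b) ∧
      ∀ x ∈ Ioo (c - δ) (c + δ) ×ˢ Ioo (-b) b, pd2 V x + Complex.I * lam * V x =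
        Φ (x.1 + (1 : ℝ) * x.2 * Complex.I) - Φ (x.1 + (-1 : ℝ) * x.2 * Complex.I) := by
  set S : Set ℂ := Ioo (c - δ) (c + δ) ×ℂ Ioo (-b) b with hS
  have hSo : IsOpen S := isOpen_Ioo.reProdIm isOpen_Ioo
  have hSc : Convex ℝ S := convex_rect _ _ _ _
  have hRo : IsOpen (Ioo (c - δ) (c + δ) ×ˢ Ioo (-b) b) := isOpen_Ioo.prod isOpen_Ioo
  have key : ∀ μ : ℂ, ∃ B : ℂ → ℂ, ∀ z ∈ S, HasDerivAt B (-μ * B z - Complex.I * Φ z) z := by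
    intro μ
    obtain ⟨P, hP⟩ := hSc.exists_forall_hasDerivWithinAt
      (f := fun z => -Complex.I * (Complex.exp (μ * z) * Φ z))
      ((DifferentiableOn.mul (by fun_prop) hΦ).const_mul _)
    refine ⟨fun z => Complex.exp (-(μ * z)) * P z, fun z hz => ?_⟩
    have h1 : HasDerivAt (fun z => Complex.exp (-(μ * z))) (Complex.exp (-(μ * z)) * -(μ * 1)) z :=
      (((hasDerivAt_id z).const_mul μ).neg).cexp
    refine (h1.mul ((hP z hz).hasDerivAt (hSo.mem_nhds hz))).congr_deriv ?_
    have q2 : Complex.exp (-(μ * z)) * Complex.exp (μ * z) = 1 := by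
      rw [← Complex.exp_add]; simp
    linear_combination (-Complex.I * Φ z) * q2
  obtain ⟨A, hA⟩ := key lam
  obtain ⟨B, hB⟩ := key (-lam)
  have dA : DifferentiableOn ℂ A S := fun z hz => (hA z hz).differentiableAt.differentiableWithinAt
  have dB : DifferentiableOn ℂ B S := fun z hz => (hB z hz).differentiableAt.differentiableWithinAt
  have m1 : ∀ x ∈ Ioo (c - δ) (c + δ) ×ˢ Ioo (-b) b, (x.1 + (1 : ℝ) * x.2 * Complex.I : ℂ) ∈ S :=
    fun p hp => ⟨by simpa using hp.1, by simpa using hp.2⟩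
  have m2 : ∀ x ∈ Ioo (c - δ) (c + δ) ×ˢ Ioo (-b) b, (x.1 + (-1 : ℝ) * x.2 * Complex.I : ℂ) ∈ S :=
    fun p hp => ⟨by simpa using hp.1, by
      have h1 := hp.2.1
      have h2 := hp.2.2
      simp only [mem_preimage]
      simp
      constructor <;> linarith⟩
  have a1 := harm_plus hSo dA 1 (by norm_num)
  have a2 := harm_plus hSo dB (-1) (by norm_num)
  have b1 : HarmonicOn (fun x => A (x.1 + (1 : ℝ) * x.2 * Complex.I))
    (Ioo (c - δ) (c + δ) ×ˢ Ioo (-b) b) := ⟨a1.1.mono m1, fun x hx => a1.2 x (m1 x hx)⟩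
  have b2 : HarmonicOn (fun x => B (x.1 + (-1 : ℝ) * x.2 * Complex.I))
    (Ioo (c - δ) (c + δ) ×ˢ Ioo (-b) b) := ⟨a2.1.mono m2, fun x hx => a2.2 x (m2 x hx)⟩
  refine ⟨_, harm_lin hRo 1 b1 b2, fun x hx => ?_⟩
  have e := ((hasDerivAt_pd2 (diffAt_of (by norm_num) hRo b1.1 hx)).add
      ((hasDerivAt_pd2 (diffAt_of (by norm_num) hRo b2.1 hx)).const_mul 1)).deriv
  rw [pd2_hol hSo dA 1 (m1 x hx), pd2_hol hSo dB (-1) (m2 x hx)] at e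
  simp only at e
  rw [(hA _ (m1 x hx)).deriv, (hB _ (m2 x hx)).deriv] at e
  have e' : pd2 (fun x => A (x.1 + (1 : ℝ) * x.2 * Complex.I) +
    1 * B (x.1 + (-1 : ℝ) * x.2 * Complex.I)) x = _ := e
  rw [e']
  simp only [Complex.ofReal_one, Complex.ofReal_neg]
  linear_combination (Φ (x.1 + -1 * x.2 * Complex.I) - Φ (x.1 + 1 * x.2 * Complex.I)) * Complex.I_sq

lemma core3 (lam : ℂ) {c δ b : ℝ} (hb : 0 < b) (w g1 g2 : ℝ × ℝ → ℂ)
    (hw : HarmonicOn w (Ioo (c - δ) (c + δ) ×ˢ Ioo 0 b))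
    (hwc : ContinuousOn w (Icc (c - δ) (c + δ) ×ˢ Icc 0 b))
    (hg : ∀ x ∈ Ioo (c - δ) (c + δ) ×ˢ Ioo 0 b, g1 x = pd1 w x ∧ g2 x = pd2 w x)
    (hg1 : ContinuousOn g1 (Icc (c - δ) (c + δ) ×ˢ Icc 0 b))
    (hg2 : ContinuousOn g2 (Icc (c - δ) (c + δ) ×ˢ Icc 0 b))
    (hbc : ∀ t ∈ Ioo (c - δ) (c + δ), g2 (t, 0) + Complex.I * lam * w (t, 0) = 0) :
    HarmonicOn (reflExt lam w) (Ioo (c - δ) (c + δ) ×ˢ Ioo (-b) b) := by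
  obtain ⟨Φ, hΦ, hΦ2⟩ := core1 lam w g1 g2 hw hwc hg hg1 hg2 hbc
  obtain ⟨V, hV, hV2⟩ := core2 lam hΦ
  set R : Set (ℝ × ℝ) := Ioo (c - δ) (c + δ) ×ˢ Ioo (-b) b with hR
  set Rp : Set (ℝ × ℝ) := Ioo (c - δ) (c + δ) ×ˢ Ioo 0 b with hRp
  have hRo : IsOpen R := isOpen_Ioo.prod isOpen_Ioo
  have hRpo : IsOpen Rp := isOpen_Ioo.prod isOpen_Ioo
  have hRpR : Rp ⊆ R := prod_mono subset_rfl (Ioo_subset_Ioo_left (by linarith))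
  set a : ℝ := b / 2 with ha
  have ha0 : a ∈ Ioo 0 b := ⟨by positivity, by linarith⟩
  have ha1 : a ∈ Ioo (-b) b := ⟨by linarith [ha0.1], ha0.2⟩
  set q : ℝ × ℝ → ℂ := fun x => w x + (-1) * V x with hq
  have hqh : HarmonicOn q Rp :=
    harm_lin hRpo (-1) hw ⟨hV.1.mono hRpR, fun x hx => hV.2 x (hRpR hx)⟩
  set T : ℝ × ℝ → ℂ := fun x => Complex.exp (Complex.I * lam * (a - x.2)) * q (x.1, a) with hT
  have hmain : EqOn (reflExt lam w) (fun x => V x + 1 * T x) R := by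
    intro x hx
    have := ode_lemma lam (b := b) (fun s => w (x.1, s)) (fun s => pd2 w (x.1, s))
      (fun s => V (x.1, s)) (fun s => pd2 V (x.1, s))
      (fun s => Φ (x.1 + (1 : ℝ) * s * Complex.I) - Φ (x.1 + (-1 : ℝ) * s * Complex.I))
      (hwc.comp (Continuous.continuousOn (by fun_prop))
        (fun s hs => ⟨Ioo_subset_Icc_self hx.1, hs⟩))
      (fun t ht => hasDerivAt_pd2 (x := (x.1, t)) (diffAt_of (by norm_num) hRpo hw.1 ⟨hx.1, ht⟩))
      (fun t ht => hasDerivAt_pd2 (x := (x.1, t)) (diffAt_of (by norm_num) hRo hV.1 ⟨hx.1, ht⟩))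
      (fun t ht => hΦ2 (x.1, t) ⟨hx.1, ht⟩)
      (fun t ht => hV2 (x.1, t) ⟨hx.1, ht⟩)
      (fun t => by simp) ha1 hx.2 (fun y => reflExt lam w (x.1, y)) rfl
    have r : reflExt lam w (x.1, a) = w (x.1, a) := by
      simp only [reflExt]; rw [if_pos ha0.1.le]
    rw [r] at this
    have q2 : Complex.exp (-(Complex.I * lam * x.2)) * Complex.exp (Complex.I * lam * x.2) = 1 := by
      rw [← Complex.exp_add]; simp
    have q3 : Complex.exp (Complex.I * lam * (a - x.2)) =
        Complex.exp (-(Complex.I * lam * x.2)) * Complex.exp (Complex.I * lam * a) := by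
      rw [← Complex.exp_add]; congr 1; ring
    simp only [hT, hq]
    rw [q3]
    change reflExt lam w (x.1, x.2) = V (x.1, x.2) + _
    linear_combination Complex.exp (-(Complex.I * lam * x.2)) * this -
      (reflExt lam w (x.1, x.2) - V (x.1, x.2)) * q2
  refine harm_congr hRo hmain (harm_lin hRo 1 hV ?_)
  have hqT : EqOn q T Rp := by
    intro x hx
    have h1 := hmain (hRpR hx)
    have r : reflExt lam w x = w x := by
      simp only [reflExt]; rw [if_pos hx.2.1.le]
    rw [r] at h1
    simp only [hq]
    linear_combination h1
  have hTa : ∀ x : ℝ, T (x, a) = q (x, a) := by intro x; simp [hT]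
  have hma : ∀ x ∈ R, (x.1, a) ∈ Rp := fun x hx => ⟨hx.1, ha0⟩
  have p2 : ∀ m : ℂ, pd2 (fun x => m * T x) = fun x => m * (-(Complex.I * lam)) * T x := by
    intro m
    funext x
    have k3 : HasDerivAt (fun y : ℝ => Complex.exp (Complex.I * lam * (a - (y : ℂ))))
        (Complex.exp (Complex.I * lam * (a - (x.2 : ℂ))) * (Complex.I * lam * -1)) x.2 :=
      (((Complex.ofRealCLM.hasDerivAt (x := x.2)).const_sub (a : ℂ)).const_mul
        (Complex.I * lam)).cexp
    have := ((k3.mul_const (q (x.1, a))).const_mul m).deriv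
    refine Eq.trans this ?_
    simp only [hT]
    ring
  have p22 : pd2 (pd2 T) = fun x => -(Complex.I * lam) * (-(Complex.I * lam)) * T x := by
    have h1 : pd2 T = fun x => -(Complex.I * lam) * T x := by
      have := p2 1
      simpa using this
    rw [h1, p2]
  have p1 : EqOn (pd1 T)
      (fun x => Complex.exp (Complex.I * lam * (a - x.2)) * pd1 q (x.1, a)) R := by
    intro x hx
    exact ((hasDerivAt_pd1 (x := (x.1, a))
      (diffAt_of (by norm_num) hRpo hqh.1 (hma x hx))).const_mul
        (Complex.exp (Complex.I * lam * (a - x.2)))).deriv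
  have p11 : EqOn (pd1 (pd1 T))
      (fun x => Complex.exp (Complex.I * lam * (a - x.2)) * pd1 (pd1 q) (x.1, a)) R := by
    intro x hx
    rw [pd1_congr hRo p1 hx]
    exact ((hasDerivAt_pd1 (x := (x.1, a)) (diffAt_of (by norm_num) hRpo
      (contDiffOn_pd1 hRpo hqh.1) (hma x hx))).const_mul
        (Complex.exp (Complex.I * lam * (a - x.2)))).deriv
  refine ⟨?_, fun x hx => ?_⟩
  · have a2 : ContDiff ℝ 2 (fun x : ℝ × ℝ => (x.2 : ℂ)) :=
      Complex.ofRealCLM.contDiff.comp contDiff_snd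
    refine ContDiffOn.mul (ContDiff.contDiffOn ?_) ?_
    · exact (contDiff_const.mul (contDiff_const.sub a2)).cexp
    · exact hqh.1.comp (f := fun x : ℝ × ℝ => ((x.1, a) : ℝ × ℝ))
        (ContDiff.contDiffOn (contDiff_fst.prodMk contDiff_const)) hma
  · have h1 := hqh.2 _ (hma x hx)
    rw [pd2_congr hRpo (pd2_congr hRpo hqT) (hma x hx), p22] at h1
    rw [p11 hx, p22]
    simp only [hTa] at h1 ⊢
    simp only [hT]
    linear_combination Complex.exp (Complex.I * lam * (a - x.2)) * h1

/-- **Point-to-point reflection for harmonic functions under the column condition.**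
If `Ω` is symmetric w.r.t. `L` and satisfies the column condition, `w` is harmonic on `Ω⁺`,
`w, ∂₁w, ∂₂w` extend continuously to `Ω⁺ ∪ L̃` (extensions `g1, g2`), and `∂₂w + iλw = 0`
on `L̃`, then the explicitly reflected function is harmonic on all of `Ω`. -/
theorem harmonic_reflection_column
    (lam : ℂ) (Ω : Set (ℝ × ℝ)) (hΩo : IsOpen Ω) (hΩc : IsConnected Ω)
    (hsym : SymmetricWrtL Ω) (hcol : ColumnCond Ω)
    (w g1 g2 : ℝ × ℝ → ℂ)
    (hw : HarmonicOn w (Opos Ω))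
    (hwc : ContinuousOn w (Opos Ω ∪ Ltil Ω))
    (hg : ∀ x ∈ Opos Ω, g1 x = pd1 w x ∧ g2 x = pd2 w x)
    (hg1 : ContinuousOn g1 (Opos Ω ∪ Ltil Ω))
    (hg2 : ContinuousOn g2 (Opos Ω ∪ Ltil Ω))
    (hbc : ∀ x ∈ Ltil Ω, g2 x + Complex.I * lam * w x = 0) :
    HarmonicOn (reflExt lam w) Ω := by
  rw [show HarmonicOn (reflExt lam w) Ω ↔ ∀ p ∈ Ω, ∃ R : Set (ℝ × ℝ), IsOpen R ∧ p ∈ R ∧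
    HarmonicOn (reflExt lam w) R from ⟨fun h p hp => ⟨Ω, hΩo, hp, h⟩, fun h =>
      ⟨fun p hp => by
        obtain ⟨R, hR, hpR, hh⟩ := h p hp
        exact (hh.1.contDiffAt (hR.mem_nhds hpR)).contDiffWithinAt, fun p hp => by
        obtain ⟨R, hR, hpR, hh⟩ := h p hp
        exact hh.2 p hpR⟩⟩]
  intro p hp
  set m : ℝ := |p.2| with hm
  have hm0 : 0 ≤ m := abs_nonneg _
  have hpm : ((p.1, m) : ℝ × ℝ) ∈ Ω := by
    rcases abs_cases p.2 with h | h
    · rw [hm, h.1]; exact hp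
    · rw [hm, h.1]; exact (hsym p).mp hp
  have hseg0 : ∀ s : ℝ, 0 ≤ s → s ≤ m → ((p.1, s) : ℝ × ℝ) ∈ Ω := by
    intro s hs hsm
    rcases hsm.eq_or_lt with rfl | hsm
    · exact hpm
    have hc := hcol (p.1, m) ⟨hpm, hs.trans_lt hsm⟩
    rcases hs.eq_or_lt with rfl | hs
    · exact hc.1.1
    · exact (hc.2 s hs hsm).1
  have hseg : ({p.1} : Set ℝ) ×ˢ Icc (-m) m ⊆ Ω := by
    rintro ⟨x, s⟩ ⟨hx, hs⟩
    obtain rfl : x = p.1 := hx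
    rcases le_total 0 s with h | h
    · exact hseg0 s h hs.2
    · have := (hsym _).mp (hseg0 (-s) (by linarith) (by have := hs.1; simp only at this; linarith))
      simpa using this
  obtain ⟨ε, hε, hsub⟩ := (isCompact_singleton.prod isCompact_Icc).exists_cthickening_subset_open
    hΩo hseg
  set b : ℝ := m + ε with hb
  have hb0 : 0 < b := by positivity
  have hbig : Icc (p.1 - ε) (p.1 + ε) ×ˢ Icc (-b) b ⊆ Ω := by
    rintro ⟨x, y⟩ ⟨hx, hy⟩
    apply hsub
    simp only [mem_Icc] at hx hy
    refine Metric.mem_cthickening_of_dist_le _ ((p.1, max (-m) (min y m)) : ℝ × ℝ) ε _ ?_ ?_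
    · exact ⟨rfl, le_max_left _ _, max_le (by linarith) (min_le_right _ _)⟩
    · rw [Prod.dist_eq]
      apply max_le
      · rw [Real.dist_eq, abs_le]; constructor <;> simp only <;> linarith
      · rw [Real.dist_eq, abs_le]
        simp only
        rcases max_cases (-m) (min y m) with h | h <;> rcases min_cases y m with h' | h' <;>
          constructor <;> linarith
  have hK : Icc (p.1 - ε) (p.1 + ε) ×ˢ Icc 0 b ⊆ Opos Ω ∪ Ltil Ω := by
    rintro ⟨x, y⟩ ⟨hx, hy⟩
    simp only at hy
    have hmem : ((x, y) : ℝ × ℝ) ∈ Ω := hbig ⟨hx, by linarith [hy.1], hy.2⟩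
    rcases hy.1.eq_or_lt with h | h
    · exact Or.inr ⟨hmem, h.symm⟩
    · exact Or.inl ⟨hmem, h⟩
  have hRp : Ioo (p.1 - ε) (p.1 + ε) ×ˢ Ioo 0 b ⊆ Opos Ω := by
    rintro ⟨x, y⟩ ⟨hx, hy⟩
    simp only at hy
    exact ⟨hbig ⟨Ioo_subset_Icc_self hx, by linarith [hy.1], hy.2.le⟩, hy.1⟩
  refine ⟨Ioo (p.1 - ε) (p.1 + ε) ×ˢ Ioo (-b) b, isOpen_Ioo.prod isOpen_Ioo, ?_,
    core3 lam hb0 w g1 g2 ⟨hw.1.mono hRp, fun x hx => hw.2 x (hRp hx)⟩ (hwc.mono hK)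
      (fun x hx => hg x (hRp hx)) (hg1.mono hK) (hg2.mono hK) ?_⟩
  · have h1 := abs_le.mp (le_of_eq hm.symm)
    exact ⟨⟨by linarith, by linarith⟩, by linarith [h1.1], by linarith [h1.2]⟩
  · intro t ht
    exact hbc (t, 0) ⟨hbig ⟨Ioo_subset_Icc_self ht, by linarith, hb0.le⟩, rfl⟩
end
end

section
/- Let k > 0 and λ > 0 be constants, and let G ⊂ ℝ² be an open set containing the closed upper half-plane {x ∈ ℝ² : x₂ ≥ 0}. Suppose u solves the Helmholtz equation Δu + k²u = 0 on G and satisfies ∂₂u(x₁,0) + iλ u(x₁,0) = 0 for every x₁ ∈ ℝ. Then there exists a function Ũ : ℝ² → ℂ such that ΔŨ + k²Ũ = 0 on all of ℝ² and Ũ(x) = u(x) for every x with x₂ ≥ 0. -/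
noncomputable section

open Set

open Filter Topology MeasureTheory

def hpH : Set (ℝ × ℝ) := {z | 0 ≤ z.2}

def hpK (c : ℂ) (f : ℝ × ℝ → ℂ) (z : ℝ × ℝ) : ℂ :=
  ∫ s in (0:ℝ)..z.2, Complex.exp (-c * (s:ℂ)) * f (z.1, |s|)

def hpJ (c : ℂ) (f : ℝ × ℝ → ℂ) (z : ℝ × ℝ) : ℂ :=
  Complex.exp (c * (z.2 : ℂ)) * hpK c f z

def hpGlue (P Q : ℝ × ℝ → ℂ) (z : ℝ × ℝ) : ℂ :=
  if 0 ≤ z.2 then P z else Q (z.1, -z.2)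

lemma hp_abs {f : ℝ × ℝ → ℂ} (hf : ContinuousOn f hpH) :
    Continuous (fun z : ℝ × ℝ => f (z.1, |z.2|)) :=
  hf.comp_continuous (by fun_prop) (fun z => abs_nonneg z.2)

lemma hpJ_cont (c : ℂ) {f : ℝ × ℝ → ℂ} (hf : ContinuousOn f hpH) : Continuous (hpJ c f) := by
  have h := hp_abs hf
  have h2 : Continuous (hpK c f) := by
    unfold hpK
    apply intervalIntegral.continuous_parametric_intervalIntegral_of_continuous (a₀ := 0) ?_ continuous_snd
    have : Continuous (fun p : (ℝ × ℝ) × ℝ => f (p.1.1, |p.2|)) :=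
      h.comp (f := fun p : (ℝ × ℝ) × ℝ => (p.1.1, p.2)) (by fun_prop)
    simp only [Function.uncurry_def]
    exact Continuous.mul (by fun_prop) this
  unfold hpJ
  fun_prop

lemma hpJ_zero (c : ℂ) (f : ℝ × ℝ → ℂ) (x : ℝ) : hpJ c f (x, 0) = 0 := by
  simp [hpJ, hpK]

lemma hp_exp_deriv (c : ℂ) (y : ℝ) :
    HasDerivAt (fun s : ℝ => Complex.exp (c * (s:ℂ))) (c * Complex.exp (c * (y:ℂ))) y := by
  have h1 : HasDerivAt (fun s : ℝ => c * (s:ℂ)) (c * 1) y :=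
    (Complex.ofRealCLM.hasDerivAt (x := y)).const_mul c
  have := h1.cexp
  convert this using 1
  ring

lemma hpJ_dy (c : ℂ) {f : ℝ × ℝ → ℂ} (hf : ContinuousOn f hpH) (x y : ℝ) (hy : 0 ≤ y) :
    HasDerivAt (fun s => hpJ c f (x, s)) (f (x, y) + c * hpJ c f (x, y)) y := by
  have h : Continuous (fun s : ℝ => f (x, |s|)) :=
    (hp_abs hf).comp (f := fun s : ℝ => (x, s)) (by fun_prop)
  have hc : Continuous (fun s : ℝ => Complex.exp (-c * (s:ℂ)) * f (x, |s|)) := Continuous.mul (by fun_prop) h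
  have hK : HasDerivAt (fun s => hpK c f (x, s)) (Complex.exp (-c * (y:ℂ)) * f (x, |y|)) y :=
    hc.integral_hasStrictDerivAt 0 y |>.hasDerivAt
  have := (hp_exp_deriv c y).mul hK
  refine this.congr_deriv ?_
  have e : Complex.exp (c * (y:ℂ)) * Complex.exp (-c * (y:ℂ)) = 1 := by
    rw [← Complex.exp_add]; simp
  rw [abs_of_nonneg hy]
  simp only [hpJ]
  linear_combination (f (x, y)) * e

lemma hpJ_dx (c : ℂ) {f g : ℝ × ℝ → ℂ} (hf : ContinuousOn f hpH) (hg : ContinuousOn g hpH)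
    (hd : ∀ x y, 0 ≤ y → HasDerivAt (fun s => f (s, y)) (g (x, y)) x) (x y : ℝ) :
    HasDerivAt (fun s => hpJ c f (s, y)) (hpJ c g (x, y)) x := by
  have hfa := hp_abs hf
  have hga := hp_abs hg
  have hF : Continuous (fun p : ℝ × ℝ => Complex.exp (-c * (p.2:ℂ)) * f (p.1, |p.2|)) :=
    Continuous.mul (by fun_prop) hfa
  have hG : Continuous (fun p : ℝ × ℝ => Complex.exp (-c * (p.2:ℂ)) * g (p.1, |p.2|)) :=
    Continuous.mul (by fun_prop) hga
  obtain ⟨M, hM⟩ := ((isCompact_Icc (a := x - 1) (b := x + 1)).prod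
    (isCompact_uIcc (a := (0:ℝ)) (b := y))).exists_bound_of_continuousOn hG.continuousOn
  have key := intervalIntegral.hasDerivAt_integral_of_dominated_loc_of_deriv_le (μ := volume)
    (F := fun s t => Complex.exp (-c * (t:ℂ)) * f (s, |t|))
    (F' := fun s t => Complex.exp (-c * (t:ℂ)) * g (s, |t|)) (x₀ := x) (a := 0) (b := y)
    (s := Icc (x-1) (x+1)) (bound := fun _ => M)
    (Icc_mem_nhds (by linarith) (by linarith))
    (Eventually.of_forall fun s => (hF.comp (f := fun t : ℝ => (s, t)) (by fun_prop)).aestronglyMeasurable)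
    ((hF.comp (f := fun t : ℝ => (x, t)) (by fun_prop)).intervalIntegrable _ _)
    ((hG.comp (f := fun t : ℝ => (x, t)) (by fun_prop)).aestronglyMeasurable)
    (Eventually.of_forall fun t ht s hs => hM (s, t) ⟨hs, uIoc_subset_uIcc ht⟩)
    (by simp)
    (Eventually.of_forall fun t _ s _ => (hd s |t| (abs_nonneg t)).const_mul _)
  exact key.2.const_mul (Complex.exp (c * (y:ℂ)))

lemma hpJ_ibp (c : ℂ) {f g : ℝ × ℝ → ℂ} (hf : ContinuousOn f hpH) (hg : ContinuousOn g hpH)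
    (hd : ∀ x y, 0 ≤ y → HasDerivAt (fun s => f (x, s)) (g (x, y)) y) (x y : ℝ) (hy : 0 ≤ y) :
    hpJ c g (x, y) = f (x, y) - Complex.exp (c * (y:ℂ)) * f (x, 0) + c * hpJ c f (x, y) := by
  have h1 : Continuous (fun s : ℝ => f (x, |s|)) :=
    (hp_abs hf).comp (f := fun s : ℝ => (x, s)) (by fun_prop)
  have h2 : Continuous (fun s : ℝ => g (x, |s|)) :=
    (hp_abs hg).comp (f := fun s : ℝ => (x, s)) (by fun_prop)
  have hc1 : Continuous (fun s : ℝ => Complex.exp (-c * (s:ℂ)) * f (x, |s|)) := Continuous.mul (by fun_prop) h1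
  have hc2 : Continuous (fun s : ℝ => Complex.exp (-c * (s:ℂ)) * g (x, |s|)) := Continuous.mul (by fun_prop) h2
  have ftc := intervalIntegral.integral_eq_sub_of_hasDerivAt (a := 0) (b := y)
    (f := fun s : ℝ => Complex.exp (-c * (s:ℂ)) * f (x, s))
    (f' := fun s : ℝ => Complex.exp (-c * (s:ℂ)) * g (x, |s|)
      - c * (Complex.exp (-c * (s:ℂ)) * f (x, |s|))) ?_ ?_
  · rw [intervalIntegral.integral_sub (hc2.intervalIntegrable _ _)
      ((hc1.const_mul c).intervalIntegrable _ _), intervalIntegral.integral_const_mul] at ftc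
    change hpK c g (x, y) - c * hpK c f (x, y) = _ at ftc
    have e : Complex.exp (c * (y:ℂ)) * Complex.exp (-c * (y:ℂ)) = 1 := by
      rw [← Complex.exp_add]; simp
    simp only [hpJ]
    simp at ftc e
    linear_combination Complex.exp (c * (y:ℂ)) * ftc + f (x, y) * e
  · intro s hs
    rw [uIcc_of_le hy] at hs
    refine ((hp_exp_deriv (-c) s).mul (hd x s hs.1)).congr_deriv ?_
    rw [abs_of_nonneg hs.1]; ring
  · exact (hc2.sub (hc1.const_mul c)).intervalIntegrable _ _

lemma hpGlue_cont {P Q : ℝ × ℝ → ℂ} (hP : ContinuousOn P hpH) (hQ : ContinuousOn Q hpH)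
    (h0 : ∀ x, P (x, 0) = Q (x, 0)) : Continuous (hpGlue P Q) := by
  have : hpGlue P Q = fun z => if 0 ≤ z.2 then P (z.1, |z.2|) else Q (z.1, |z.2|) := by
    funext z
    unfold hpGlue
    split_ifs with h
    · rw [abs_of_nonneg h]
    · rw [abs_of_neg (not_le.1 h)]
  rw [this]
  refine Continuous.if_le (hp_abs hP) (hp_abs hQ) continuous_const continuous_snd ?_
  intro z hz
  rw [← hz]; simpa using h0 z.1

lemma hpGlue_dx {P Q P' Q' : ℝ × ℝ → ℂ}
    (hP : ∀ x y, 0 ≤ y → HasDerivAt (fun s => P (s, y)) (P' (x, y)) x)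
    (hQ : ∀ x y, 0 ≤ y → HasDerivAt (fun s => Q (s, y)) (Q' (x, y)) x) (x y : ℝ) :
    HasDerivAt (fun s => hpGlue P Q (s, y)) (hpGlue P' Q' (x, y)) x := by
  unfold hpGlue
  by_cases h : 0 ≤ y
  · simpa [h] using hP x y h
  · simpa [h] using hQ x (-y) (by linarith)

lemma hpGlue_dy {P Q P' Q' : ℝ × ℝ → ℂ}
    (hP : ∀ x y, 0 ≤ y → HasDerivAt (fun s => P (x, s)) (P' (x, y)) y)
    (hQ : ∀ x y, 0 ≤ y → HasDerivAt (fun s => Q (x, s)) (-Q' (x, y)) y)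
    (h0 : ∀ x, P (x, 0) = Q (x, 0)) (h0' : ∀ x, P' (x, 0) = Q' (x, 0)) (x y : ℝ) :
    HasDerivAt (fun s => hpGlue P Q (x, s)) (hpGlue P' Q' (x, y)) y := by
  have hQn : ∀ y, y ≤ 0 → HasDerivAt (fun s => Q (x, -s)) (Q' (x, -y)) y := by
    intro y hy
    have := (hQ x (-y) (by linarith)).scomp y (hasDerivAt_neg y)
    simpa [Function.comp_def] using this
  rcases lt_trichotomy y 0 with h | h | h
  · have : hpGlue P' Q' (x, y) = Q' (x, -y) := by simp [hpGlue, h]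
    rw [this]
    refine (hQn y h.le).congr_of_eventuallyEq ?_
    filter_upwards [Iio_mem_nhds h] with s hs
    have : ¬ (0 ≤ s) := not_le.2 hs
    simp [hpGlue, this]
  · subst h
    have e : hpGlue P' Q' (x, 0) = P' (x, 0) := by simp [hpGlue]
    rw [e, ← hasDerivWithinAt_univ, ← Iic_union_Ici (a := (0:ℝ))]
    refine HasDerivWithinAt.union ?_ ?_
    · have := (hQn 0 le_rfl).hasDerivWithinAt (s := Iic 0)
      rw [neg_zero, ← h0'] at this
      refine this.congr ?_ ?_
      · intro s hs
        rcases (show s ≤ 0 from hs).lt_or_eq with h | h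
        · simp [hpGlue, h]
        · simp [hpGlue, h, h0]
      · simp [hpGlue, h0]
    · refine ((hP x 0 le_rfl).hasDerivWithinAt (s := Ici 0)).congr ?_ ?_
      · intro s hs
        have : 0 ≤ s := hs
        simp [hpGlue, this]
      · simp [hpGlue]
  · have : hpGlue P' Q' (x, y) = P' (x, y) := by simp [hpGlue, h.le]
    rw [this]
    refine (hP x y h.le).congr_of_eventuallyEq ?_
    filter_upwards [Ioi_mem_nhds h] with s hs
    have : 0 ≤ s := le_of_lt hs
    simp [hpGlue, this]

lemma hp_contDiff_succ (n : ℕ) {f f1 f2 : ℝ × ℝ → ℂ}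
    (h1 : ∀ x y, HasDerivAt (fun s => f (s, y)) (f1 (x, y)) x)
    (h2 : ∀ x y, HasDerivAt (fun s => f (x, s)) (f2 (x, y)) y)
    (c1 : ContDiff ℝ n f1) (c2 : ContDiff ℝ n f2) : ContDiff ℝ (n + 1) f := by
  let L : ℂ →L[ℝ] (ℝ →L[ℝ] ℂ) := ContinuousLinearMap.smulRightL ℝ ℝ ℂ 1
  let T1 : ℂ →L[ℝ] (ℝ × ℝ →L[ℝ] ℂ) :=
    ContinuousLinearMap.smulRightL ℝ (ℝ × ℝ) ℂ (ContinuousLinearMap.fst ℝ ℝ ℝ)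
  let T2 : ℂ →L[ℝ] (ℝ × ℝ →L[ℝ] ℂ) :=
    ContinuousLinearMap.smulRightL ℝ (ℝ × ℝ) ℂ (ContinuousLinearMap.snd ℝ ℝ ℝ)
  have hd : ∀ z, HasFDerivAt f (T1 (f1 z) + T2 (f2 z)) z := by
    intro z
    have := (hasStrictFDerivAt_uncurry_coprod (𝕜 := ℝ) (u := z) (f := fun a b => f (a, b))
      (f₁ := fun a b => L (f1 (a, b))) (f₂ := fun a b => L (f2 (a, b)))
      (Eventually.of_forall fun v => (h1 v.1 v.2).hasFDerivAt)
      (Eventually.of_forall fun v => (h2 v.1 v.2).hasFDerivAt)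
      (L.continuous.comp c1.continuous).continuousAt
      (L.continuous.comp c2.continuous).continuousAt).hasFDerivAt
    refine this.congr_fderiv ?_
    ext <;> simp [L, T1, T2, Function.HasUncurry.uncurry]
  rw [contDiff_succ_iff_fderiv]
  refine ⟨fun z => (hd z).differentiableAt, by simp, ?_⟩
  rw [funext fun z => (hd z).fderiv]
  exact (T1.contDiff.comp c1).add (T2.contDiff.comp c2)

lemma hp_line1 {f : ℝ × ℝ → ℂ} {x y : ℝ} (hf : DifferentiableAt ℝ f (x, y)) :
    HasDerivAt (fun s => f (s, y)) (fderiv ℝ f (x, y) (1, 0)) x := by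
  have h : HasDerivAt (fun s : ℝ => (s, y)) ((1:ℝ), (0:ℝ)) x :=
    (hasDerivAt_id x).prodMk (hasDerivAt_const x y)
  exact HasFDerivAt.comp_hasDerivAt (f := fun s : ℝ => (s, y)) x hf.hasFDerivAt h

lemma hp_line2 {f : ℝ × ℝ → ℂ} {x y : ℝ} (hf : DifferentiableAt ℝ f (x, y)) :
    HasDerivAt (fun s => f (x, s)) (fderiv ℝ f (x, y) (0, 1)) y := by
  have h : HasDerivAt (fun s : ℝ => (x, s)) ((0:ℝ), (1:ℝ)) y :=
    (hasDerivAt_const y x).prodMk (hasDerivAt_id y)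
  exact HasFDerivAt.comp_hasDerivAt (f := fun s : ℝ => (x, s)) y hf.hasFDerivAt h

lemma hp_fd {G : Set (ℝ × ℝ)} (hG : IsOpen G) {f : ℝ × ℝ → ℂ} (n : ℕ)
    (hf : ContDiffOn ℝ (n + 1) f G) (v : ℝ × ℝ) :
    ContDiffOn ℝ n (fun z => fderiv ℝ f z v) G :=
  ((contDiffOn_succ_iff_fderiv_of_isOpen hG).1 hf).2.2.clm_apply contDiffOn_const

theorem helmholtz_half_plane_extension
    (k lam : ℝ) (hk : 0 < k) (hlam : 0 < lam)
    (G : Set (ℝ × ℝ)) (hGo : IsOpen G) (hG : {x : ℝ × ℝ | 0 ≤ x.2} ⊆ G)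
    (u : ℝ × ℝ → ℂ) (hu : HelmholtzEq (k : ℂ) u G)
    (hbc : ∀ x₁ : ℝ, pd2 u ((x₁, 0) : ℝ × ℝ)
      + Complex.I * (lam : ℂ) * u ((x₁, 0) : ℝ × ℝ) = 0) :
    ∃ U : ℝ × ℝ → ℂ, HelmholtzEq (k : ℂ) U Set.univ ∧
      ∀ x : ℝ × ℝ, 0 ≤ x.2 → U x = u x := by
  obtain ⟨hC, hpde⟩ := hu
  set c : ℂ := Complex.I * (lam : ℂ) with hc
  set ux : ℝ × ℝ → ℂ := fun z => fderiv ℝ u z (1, 0) with hux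
  set uy : ℝ × ℝ → ℂ := fun z => fderiv ℝ u z (0, 1) with huy
  set uxx : ℝ × ℝ → ℂ := fun z => fderiv ℝ ux z (1, 0) with huxx
  set uxy : ℝ × ℝ → ℂ := fun z => fderiv ℝ ux z (0, 1) with huxy
  set uyx : ℝ × ℝ → ℂ := fun z => fderiv ℝ uy z (1, 0) with huyx
  set uyy : ℝ × ℝ → ℂ := fun z => fderiv ℝ uy z (0, 1) with huyy
  have hC2 : ContDiffOn ℝ ((1:ℕ) + 1) u G := by
    have : ((1:ℕ) + 1 : WithTop ℕ∞) = 2 := by norm_num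
    rw [this]; exact hC
  have Cx : ContDiffOn ℝ (1:ℕ) ux G := hp_fd hGo 1 hC2 _
  have Cy : ContDiffOn ℝ (1:ℕ) uy G := hp_fd hGo 1 hC2 _
  have Cx' : ContDiffOn ℝ ((0:ℕ) + 1) ux G := by simpa using Cx
  have Cy' : ContDiffOn ℝ ((0:ℕ) + 1) uy G := by simpa using Cy
  have Kxx : ContinuousOn uxx hpH := (hp_fd hGo 0 Cx' _).continuousOn.mono hG
  have Kxy : ContinuousOn uxy hpH := (hp_fd hGo 0 Cx' _).continuousOn.mono hG
  have Kyx : ContinuousOn uyx hpH := (hp_fd hGo 0 Cy' _).continuousOn.mono hG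
  have Kyy : ContinuousOn uyy hpH := (hp_fd hGo 0 Cy' _).continuousOn.mono hG
  have Kx : ContinuousOn ux hpH := Cx.continuousOn.mono hG
  have Ky : ContinuousOn uy hpH := Cy.continuousOn.mono hG
  have K : ContinuousOn u hpH := hC.continuousOn.mono hG
  have D : ∀ z ∈ G, DifferentiableAt ℝ u z := fun z hz =>
    (hC.contDiffAt (hGo.mem_nhds hz)).differentiableAt (by norm_num)
  have Dx : ∀ z ∈ G, DifferentiableAt ℝ ux z := fun z hz =>
    (Cx.contDiffAt (hGo.mem_nhds hz)).differentiableAt (by norm_num)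
  have Dy : ∀ z ∈ G, DifferentiableAt ℝ uy z := fun z hz =>
    (Cy.contDiffAt (hGo.mem_nhds hz)).differentiableAt (by norm_num)
  have mem : ∀ x y : ℝ, 0 ≤ y → (x, y) ∈ G := fun x y h => hG h
  -- derivatives
  have d1 : ∀ x y, 0 ≤ y → HasDerivAt (fun s => u (s, y)) (ux (x, y)) x :=
    fun x y h => hp_line1 (D _ (mem x y h))
  have d2 : ∀ x y, 0 ≤ y → HasDerivAt (fun s => u (x, s)) (uy (x, y)) y :=
    fun x y h => hp_line2 (D _ (mem x y h))
  have d11 : ∀ x y, 0 ≤ y → HasDerivAt (fun s => ux (s, y)) (uxx (x, y)) x :=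
    fun x y h => hp_line1 (Dx _ (mem x y h))
  have d12 : ∀ x y, 0 ≤ y → HasDerivAt (fun s => ux (x, s)) (uxy (x, y)) y :=
    fun x y h => hp_line2 (Dx _ (mem x y h))
  have d21 : ∀ x y, 0 ≤ y → HasDerivAt (fun s => uy (s, y)) (uyx (x, y)) x :=
    fun x y h => hp_line1 (Dy _ (mem x y h))
  have d22 : ∀ x y, 0 ≤ y → HasDerivAt (fun s => uy (x, s)) (uyy (x, y)) y :=
    fun x y h => hp_line2 (Dy _ (mem x y h))
  -- symmetry
  have sym : ∀ z ∈ G, uxy z = uyx z := by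
    intro z hz
    have hs : IsSymmSndFDerivAt ℝ u z :=
      (hC.contDiffAt (hGo.mem_nhds hz)).isSymmSndFDerivAt (by simp)
    have hdd : DifferentiableAt ℝ (fderiv ℝ u) z :=
      ((((contDiffOn_succ_iff_fderiv_of_isOpen hGo).1 hC2).2.2).contDiffAt
        (hGo.mem_nhds hz)).differentiableAt (by norm_num)
    have e : ∀ v w, fderiv ℝ (fun z => fderiv ℝ u z v) z w = fderiv ℝ (fderiv ℝ u) z w v := by
      intro v w
      rw [fderiv_clm_apply hdd (differentiableAt_const v)]
      simp
    simp only [huxy, huyx, hux, huy, e]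
    exact hs _ _
  -- boundary conditions
  have b0 : ∀ x, uy (x, 0) + c * u (x, 0) = 0 := by
    intro x
    have h := hbc x
    have e : pd2 u (x, 0) = uy (x, 0) := (d2 x 0 le_rfl).deriv
    rwa [e] at h
  have b1 : ∀ x, uyx (x, 0) + c * ux (x, 0) = 0 := by
    intro x
    have h := (d21 x 0 le_rfl).add ((d1 x 0 le_rfl).const_mul c)
    have h' : HasDerivAt (fun _ : ℝ => (0:ℂ)) (uyx (x, 0) + c * ux (x, 0)) x :=
      h.congr_of_eventuallyEq (Eventually.of_forall fun s => (b0 s).symm)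
    exact h'.unique (hasDerivAt_const x 0)
  -- PDE
  have pde : ∀ z, 0 ≤ z.2 → uxx z + uyy z + (k:ℂ) ^ 2 * u z = 0 := by
    rintro ⟨x, y⟩ hz
    have h := hpde (x, y) (hG hz)
    have hnx : ∀ᶠ s in 𝓝 x, (s, y) ∈ G :=
      (Continuous.prodMk_left y).continuousAt.preimage_mem_nhds (hGo.mem_nhds (hG hz))
    have hny : ∀ᶠ s in 𝓝 y, (x, s) ∈ G :=
      (Continuous.prodMk_right x).continuousAt.preimage_mem_nhds (hGo.mem_nhds (hG hz))
    have e1 : pd1 (pd1 u) (x, y) = uxx (x, y) := by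
      refine ((d11 x y hz).congr_of_eventuallyEq ?_).deriv
      filter_upwards [hnx] with s hs
      exact (hp_line1 (D _ hs)).deriv
    have e2 : pd2 (pd2 u) (x, y) = uyy (x, y) := by
      refine ((d22 x y hz).congr_of_eventuallyEq ?_).deriv
      filter_upwards [hny] with s hs
      exact (hp_line2 (D _ hs)).deriv
    rwa [e1, e2] at h
  -- the extension and its derivatives
  have J := fun {f : ℝ × ℝ → ℂ} (hf : ContinuousOn f hpH) => (hpJ_cont c hf).continuousOn (s := hpH)
  have J0 := J K
  have Jx := J Kx
  have Jxx := J Kxx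
  set Q : ℝ × ℝ → ℂ := fun z => u z + 2 * c * hpJ c u z with hQ
  set Qx : ℝ × ℝ → ℂ := fun z => ux z + 2 * c * hpJ c ux z with hQx
  set Qxx : ℝ × ℝ → ℂ := fun z => uxx z + 2 * c * hpJ c uxx z with hQxx
  set Qy : ℝ × ℝ → ℂ := fun z => -(uy z + 2 * c * (u z + c * hpJ c u z)) with hQy
  set Qyx : ℝ × ℝ → ℂ := fun z => -(uyx z + 2 * c * (ux z + c * hpJ c ux z)) with hQyx
  set Qyy : ℝ × ℝ → ℂ :=
    fun z => uyy z + 2 * c * (uy z + c * (u z + c * hpJ c u z)) with hQyy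
  have v : ∀ f : ℝ × ℝ → ℂ, ∀ x : ℝ, hpJ c f (x, 0) = 0 := fun f x => hpJ_zero c f x
  have q0 : ∀ x, u (x, 0) = Q (x, 0) := fun x => by simp [hQ, v]
  have qx : ∀ x, ux (x, 0) = Qx (x, 0) := fun x => by simp [hQx, v]
  have qxx : ∀ x, uxx (x, 0) = Qxx (x, 0) := fun x => by simp [hQxx, v]
  have qy : ∀ x, uy (x, 0) = Qy (x, 0) := fun x => by
    simp only [hQy, v]; linear_combination 2 * b0 x
  have qyx : ∀ x, uyx (x, 0) = Qyx (x, 0) := fun x => by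
    simp only [hQyx, v]; linear_combination 2 * b1 x
  have qyy : ∀ x, uyy (x, 0) = Qyy (x, 0) := fun x => by
    simp only [hQyy, v]; linear_combination -2 * c * b0 x
  have E1 : ∀ x y, HasDerivAt (fun s => hpGlue u Q (s, y)) (hpGlue ux Qx (x, y)) x :=
    hpGlue_dx d1 fun x y h => (d1 x y h).add ((hpJ_dx c K Kx d1 x y).const_mul (2 * c))
  have E11 : ∀ x y, HasDerivAt (fun s => hpGlue ux Qx (s, y)) (hpGlue uxx Qxx (x, y)) x :=
    hpGlue_dx d11 fun x y h => (d11 x y h).add ((hpJ_dx c Kx Kxx d11 x y).const_mul (2 * c))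
  have E2 : ∀ x y, HasDerivAt (fun s => hpGlue u Q (x, s)) (hpGlue uy Qy (x, y)) y := by
    refine hpGlue_dy d2 (fun x y h => ?_) q0 qy
    refine ((d2 x y h).add ((hpJ_dy c K x y h).const_mul (2 * c))).congr_deriv ?_
    simp only [hQy]; ring
  have E12 : ∀ x y, HasDerivAt (fun s => hpGlue ux Qx (x, s)) (hpGlue uyx Qyx (x, y)) y := by
    refine hpGlue_dy (fun x y h => ?_) (fun x y h => ?_) qx qyx
    · rw [← sym _ (mem x y h)]; exact d12 x y h
    refine ((d12 x y h).add ((hpJ_dy c Kx x y h).const_mul (2 * c))).congr_deriv ?_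
    simp only [hQyx]; rw [sym _ (mem x y h)]; ring
  have E21 : ∀ x y, HasDerivAt (fun s => hpGlue uy Qy (s, y)) (hpGlue uyx Qyx (x, y)) x :=
    hpGlue_dx d21 fun x y h => ((d21 x y h).add
      (((d1 x y h).add ((hpJ_dx c K Kx d1 x y).const_mul c)).const_mul (2 * c))).neg
  have E22 : ∀ x y, HasDerivAt (fun s => hpGlue uy Qy (x, s)) (hpGlue uyy Qyy (x, y)) y := by
    refine hpGlue_dy d22 (fun x y h => ?_) qy qyy
    exact ((d22 x y h).add
      (((d2 x y h).add ((hpJ_dy c K x y h).const_mul c)).const_mul (2 * c))).neg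
  have k11 : ContDiff ℝ (0:ℕ) (hpGlue uxx Qxx) :=
    contDiff_zero.2 (hpGlue_cont Kxx (by fun_prop) qxx)
  have k12 : ContDiff ℝ (0:ℕ) (hpGlue uyx Qyx) :=
    contDiff_zero.2 (hpGlue_cont Kyx (by fun_prop) qyx)
  have k22 : ContDiff ℝ (0:ℕ) (hpGlue uyy Qyy) :=
    contDiff_zero.2 (hpGlue_cont Kyy (by fun_prop) qyy)
  have k1 : ContDiff ℝ (1:ℕ) (hpGlue ux Qx) := by
    simpa using hp_contDiff_succ 0 E11 E12 k11 k12
  have k2 : ContDiff ℝ (1:ℕ) (hpGlue uy Qy) := by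
    simpa using hp_contDiff_succ 0 E21 E22 k12 k22
  have k0 := hp_contDiff_succ 1 E1 E2 k1 k2
  refine ⟨hpGlue u Q, ⟨?_, ?_⟩, fun x hx => by simp [hpGlue, hx]⟩
  · have : ((1:ℕ) + 1 : WithTop ℕ∞) = 2 := by norm_num
    rw [this] at k0
    exact k0.contDiffOn
  · intro z _
    have p1 : pd1 (hpGlue u Q) = hpGlue ux Qx := funext fun z => (E1 z.1 z.2).deriv
    have p2 : pd2 (hpGlue u Q) = hpGlue uy Qy := funext fun z => (E2 z.1 z.2).deriv
    have p11 : pd1 (hpGlue ux Qx) z = hpGlue uxx Qxx z := (E11 z.1 z.2).deriv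
    have p22 : pd2 (hpGlue uy Qy) z = hpGlue uyy Qyy z := (E22 z.1 z.2).deriv
    rw [p1, p2, p11, p22]
    by_cases hz : 0 ≤ z.2
    · simpa [hpGlue, hz] using pde z hz
    · obtain ⟨x, y⟩ := z
      simp only at hz
      have hy : 0 ≤ -y := by linarith
      simp only [hpGlue, hz, if_false]
      set w := -y
      have i1 := hpJ_ibp c K Ky d2 x w hy
      have i2 := hpJ_ibp c Ky Kyy d22 x w hy
      have i3 : hpJ c uxx (x, w) + hpJ c uyy (x, w) + (k:ℂ) ^ 2 * hpJ c u (x, w) = 0 := by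
        have e : ∀ s : ℝ, uxx (x, |s|) = -uyy (x, |s|) - (k:ℂ) ^ 2 * u (x, |s|) := fun s => by
          linear_combination pde (x, |s|) (abs_nonneg s)
        have ci : ∀ {f : ℝ × ℝ → ℂ}, ContinuousOn f hpH →
            IntervalIntegrable (fun s : ℝ => Complex.exp (-c * (s:ℂ)) * f (x, |s|))
              volume 0 w := fun hf => by
          have h1 : Continuous (fun s : ℝ => _) :=
            (hp_abs hf).comp (f := fun s : ℝ => (x, s)) (by fun_prop)
          exact (Continuous.mul (by fun_prop) h1).intervalIntegrable _ _
        have e2 : hpK c uxx (x, w) = -hpK c uyy (x, w) - (k:ℂ) ^ 2 * hpK c u (x, w) := by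
          simp only [hpK]
          rw [← intervalIntegral.integral_neg, ← intervalIntegral.integral_const_mul,
            ← intervalIntegral.integral_sub (show IntervalIntegrable
              (fun s : ℝ => -(Complex.exp (-c * (s:ℂ)) * uyy (x, |s|))) volume 0 w
              from (ci Kyy).neg) ((ci K).const_mul _)]
          congr 1
          funext s
          rw [e s]; ring
        simp only [hpJ, e2]; ring
      have i4 := pde (x, w) hy
      simp only [hQ, hQxx, hQyy]
      linear_combination i4 + 2 * c * i3 - 2 * c * i2 - 2 * c * c * i1
        + 2 * c * Complex.exp (c * (w:ℂ)) * b0 x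
end
end
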